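/- arXiv:1508.01760 — 2 statements merged into one kernel-verified Lean document; each statement's English description precedes it below -/
import Mathlib

section
/- Let β ≥ 3 be an integer. There exists a constant C > 0 (depending only on β) such that for all reals x ≥ 3 and y with y ≥ x^{3β/2}(log x)^5 one has |C_{1,β}(x,y) − y| ≤ C · x^{β} y^{1/3}(log y)^4. -/
open Complex Finset
open scoped Classical

/-- The generalized Ramanujan sum of Cohen: `c_{q,β}(n) = Σ_h exp(2πinh/q^β)` where `h`
runs over `0 ≤ h < q^β` such that `h` and `q^β` have no common `β`-th power divisor `> 1`. -/
noncomputable def cohenRamanujan (β q n : ℕ) : ℂ :=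
  ∑ h ∈ (Finset.range (q ^ β)).filter
      (fun h => ∀ d : ℕ, 1 < d → ¬(d ^ β ∣ h ∧ d ^ β ∣ q ^ β)),
    Complex.exp (2 * Real.pi * Complex.I * n * h / (q ^ β))

/-- The `k`-th moment of averages `C_{k,β}(x,y) = Σ_{n ≤ y} (Σ_{q ≤ x} c_{q,β}(n))^k`. -/
noncomputable def momentC (k β : ℕ) (x y : ℝ) : ℂ :=
  ∑ n ∈ Finset.Icc 1 ⌊y⌋₊, (∑ q ∈ Finset.Icc 1 ⌊x⌋₊, cohenRamanujan β q n) ^ k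

/-- A concave lower bound for the sine on `[0, π]`. -/
lemma two_mul_mul_one_sub_le_sin {u : ℝ} (h0 : 0 ≤ u) (h1 : u ≤ 1) :
    2 * (u * (1 - u)) ≤ Real.sin (Real.pi * u) := by
  have hpi := Real.pi_pos
  rcases le_total u (1 / 2) with h | h
  · have key := Real.mul_le_sin (x := Real.pi * u) (by positivity) (by nlinarith)
    have e : 2 / Real.pi * (Real.pi * u) = 2 * u := by field_simp
    nlinarith
  · have key := Real.mul_le_sin (x := Real.pi * (1 - u))
      (mul_nonneg hpi.le (by linarith)) (by nlinarith)
    have e : 2 / Real.pi * (Real.pi * (1 - u)) = 2 * (1 - u) := by field_simp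
    have e' : Real.sin (Real.pi * (1 - u)) = Real.sin (Real.pi * u) := by
      rw [mul_sub, mul_one, Real.sin_pi_sub]
    nlinarith

/-- The geometric sum bound for additive characters. -/
lemma norm_sum_exp_le {M h : ℕ} (N : ℕ) (h0 : 0 < h) (hM : h < M) :
    ‖∑ n ∈ Finset.Icc 1 N, Complex.exp (2 * Real.pi * Complex.I * n * h / M)‖
      ≤ M / 2 * (1 / (h : ℝ) + 1 / ((M : ℝ) - h)) := by
  have hh : (0 : ℝ) < h := by exact_mod_cast h0
  have hMh : (h : ℝ) < M := by exact_mod_cast hM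
  have hM0 : (0 : ℝ) < M := hh.trans hMh
  set u : ℝ := h / M with hu
  have hu0 : 0 < u := by positivity
  have hu1 : u < 1 := (div_lt_one hM0).2 hMh
  set z : ℂ := Complex.exp (Complex.I * ((2 * Real.pi * u : ℝ) : ℂ)) with hz
  have hterm : ∀ n : ℕ, Complex.exp (2 * Real.pi * Complex.I * n * h / M) = z ^ n := by
    intro n
    rw [hz, ← Complex.exp_nat_mul]
    congr 1
    rw [hu]
    push_cast
    ring
  have hznorm : ‖z‖ = 1 := by
    rw [hz, mul_comm, Complex.norm_exp_ofReal_mul_I]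
  have hsin := two_mul_mul_one_sub_le_sin hu0.le hu1.le
  have hpos : 0 < 2 * (u * (1 - u)) := by
    have := sub_pos.2 hu1
    positivity
  have hz1 : 2 * (2 * (u * (1 - u))) ≤ ‖z - 1‖ := by
    rw [hz, Complex.norm_exp_I_mul_ofReal_sub_one]
    have e : 2 * Real.pi * u / 2 = Real.pi * u := by ring
    rw [e, Real.norm_eq_abs]
    exact le_trans (by linarith) (le_abs_self _)
  have hmul : (∑ n ∈ Finset.Icc 1 N, z ^ n) * (z - 1) = z ^ (N + 1) - z := by
    have := geom_sum_Ico_mul z (m := 1) (n := N + 1) (by omega)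
    rw [pow_one] at this
    rw [← this]
    rfl
  have hnum : ‖(∑ n ∈ Finset.Icc 1 N, z ^ n) * (z - 1)‖ ≤ 2 := by
    rw [hmul]
    refine (norm_sub_le _ _).trans ?_
    rw [norm_pow, hznorm]
    norm_num
  rw [norm_mul] at hnum
  have e : M / 2 * (1 / (h : ℝ) + 1 / ((M : ℝ) - h)) = 1 / (2 * (u * (1 - u))) := by
    have : (M : ℝ) - h ≠ 0 := (sub_pos.2 hMh).ne'
    rw [hu]
    field_simp
    ring
  rw [Finset.sum_congr rfl (fun n _ => hterm n), e, le_div_iff₀ hpos]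
  nlinarith [norm_nonneg (∑ n ∈ Finset.Icc 1 N, z ^ n)]

lemma sum_Ico_one_div_add_le (M : ℕ) (hM : 2 ≤ M) :
    ∑ h ∈ Finset.Ico 1 M, (M : ℝ) / 2 * (1 / (h : ℝ) + 1 / ((M : ℝ) - h))
      ≤ M * (1 + Real.log M) := by
  obtain ⟨m, rfl⟩ : ∃ m, M = m + 1 := ⟨M - 1, by omega⟩
  have h1 : ∑ h ∈ Finset.Ico 1 (m + 1), 1 / (h : ℝ) = (harmonic m : ℝ) := by
    rw [Finset.sum_Ico_eq_sum_range, harmonic]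
    push_cast
    refine Finset.sum_congr rfl fun i _ => ?_
    rw [one_div, add_comm]
  have h2 : ∑ h ∈ Finset.Ico 1 (m + 1), 1 / (((m + 1 : ℕ) : ℝ) - h) = (harmonic m : ℝ) := by
    have hr := Finset.sum_Ico_reflect (fun h : ℕ => 1 / (h : ℝ)) 1 (m := m + 1) (n := m + 1)
      (by omega)
    rw [show m + 1 + 1 - (m + 1) = 1 by omega, show m + 1 + 1 - 1 = m + 1 by omega, h1] at hr
    rw [← hr]
    refine Finset.sum_congr rfl fun i hi => ?_
    rw [Finset.mem_Ico] at hi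
    rw [Nat.cast_sub (by omega)]
  rw [← Finset.mul_sum, Finset.sum_add_distrib, h1, h2]
  have h3 : (harmonic m : ℝ) ≤ 1 + Real.log m := harmonic_le_one_add_log m
  have h4 : Real.log m ≤ Real.log ((m + 1 : ℕ) : ℝ) :=
    Real.log_le_log (by exact_mod_cast (by omega : 0 < m)) (by push_cast; linarith)
  have h5 : (0 : ℝ) ≤ ((m + 1 : ℕ) : ℝ) := Nat.cast_nonneg _
  nlinarith

lemma cohenRamanujan_one {β : ℕ} (hβ : β ≠ 0) (n : ℕ) : cohenRamanujan β 1 n = 1 := by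
  have h : (Finset.range (1 ^ β)).filter
      (fun h => ∀ d : ℕ, 1 < d → ¬(d ^ β ∣ h ∧ d ^ β ∣ 1 ^ β)) = {0} := by
    rw [one_pow, Finset.range_one, Finset.filter_eq_self]
    rintro h - d hd ⟨-, hd'⟩
    rw [Nat.dvd_one, Nat.pow_eq_one] at hd'
    omega
  rw [cohenRamanujan, h]
  simp

/-- The sums of `c_{q,β}` over initial segments are bounded independently of their length. -/
lemma norm_sum_cohenRamanujan_le {β q : ℕ} (hβ : β ≠ 0) (hq : 2 ≤ q) (N : ℕ) :
    ‖∑ n ∈ Finset.Icc 1 N, cohenRamanujan β q n‖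
      ≤ (q : ℝ) ^ β * (1 + β * Real.log q) := by
  have hM : 2 ≤ q ^ β := hq.trans (Nat.le_self_pow hβ q)
  have hsub : (Finset.range (q ^ β)).filter
      (fun h => ∀ d : ℕ, 1 < d → ¬(d ^ β ∣ h ∧ d ^ β ∣ q ^ β)) ⊆ Finset.Ico 1 (q ^ β) := by
    intro h hh
    rw [Finset.mem_filter, Finset.mem_range] at hh
    rw [Finset.mem_Ico]
    refine ⟨Nat.one_le_iff_ne_zero.2 ?_, hh.1⟩
    rintro rfl
    exact hh.2 q (by omega) ⟨dvd_zero _, dvd_rfl⟩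
  unfold cohenRamanujan
  rw [Finset.sum_comm]
  refine (norm_sum_le _ _).trans ?_
  have hlog : (q : ℝ) ^ β * (1 + β * Real.log q)
      = ((q ^ β : ℕ) : ℝ) * (1 + Real.log ((q ^ β : ℕ) : ℝ)) := by
    push_cast
    rw [Real.log_pow]
  rw [hlog]
  refine le_trans ?_ (sum_Ico_one_div_add_le (q ^ β) hM)
  refine (Finset.sum_le_sum_of_subset_of_nonneg hsub fun _ _ _ => norm_nonneg _).trans ?_
  refine Finset.sum_le_sum fun h hh => ?_
  rw [Finset.mem_Ico] at hh
  have := norm_sum_exp_le N hh.1 hh.2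
  push_cast at this ⊢
  exact this

theorem first_moment_sharp_large_beta (β : ℕ) (hβ : 3 ≤ β) :
    ∃ C > 0, ∀ x y : ℝ, 3 ≤ x → x ^ ((3 * (β : ℝ)) / 2) * (Real.log x) ^ 5 ≤ y →
      ‖momentC 1 β x y - (y : ℂ)‖ ≤ C * (x ^ β * y ^ ((1 : ℝ) / 3) * (Real.log y) ^ 4) := by
  refine ⟨3, by norm_num, fun x y hx hy => ?_⟩
  have hx0 : 0 < x := by linarith
  have hx1 : 1 ≤ x := by linarith
  have hlogx : 1 ≤ Real.log x := by
    rw [Real.le_log_iff_exp_le hx0]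
    linarith [Real.exp_one_lt_d9]
  have hβ' : (3 : ℝ) ≤ β := by exact_mod_cast hβ
  have hxy : x ^ ((3 * (β : ℝ)) / 2) ≤ y :=
    le_trans (le_mul_of_one_le_right (by positivity) (one_le_pow₀ hlogx)) hy
  have hxpos : 0 < x ^ ((3 * (β : ℝ)) / 2) := by positivity
  have hy0 : 0 < y := hxpos.trans_le hxy
  have hlogy : β * Real.log x ≤ Real.log y := by
    have h := Real.log_le_log hxpos hxy
    rw [Real.log_rpow hx0] at h
    nlinarith
  have hlogy1 : 1 ≤ Real.log y := by nlinarith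
  have hroot : x ≤ y ^ ((1 : ℝ) / 3) := by
    have h := Real.rpow_le_rpow hxpos.le hxy (by norm_num : (0 : ℝ) ≤ 1 / 3)
    rw [← Real.rpow_mul hx0.le] at h
    refine le_trans ?_ h
    exact Real.self_le_rpow_of_one_le hx1 (by linarith)
  have hlog4 : Real.log y ≤ Real.log y ^ 4 := le_self_pow₀ hlogy1 (by norm_num)
  have hmain : x ^ β * x * Real.log y ≤ x ^ β * y ^ ((1 : ℝ) / 3) * Real.log y ^ 4 := by
    gcongr
  have hone : 1 ≤ x ^ β * x * Real.log y := by
    have := one_le_pow₀ hx1 (n := β)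
    exact one_le_mul_of_one_le_of_one_le (one_le_mul_of_one_le_of_one_le this hx1) hlogy1
  have hfloor : 1 ≤ ⌊x⌋₊ := (Nat.one_le_floor_iff x).2 hx1
  have hdecomp : momentC 1 β x y - (y : ℂ) = ((⌊y⌋₊ : ℂ) - y)
      + ∑ q ∈ Finset.Ioc 1 ⌊x⌋₊, ∑ n ∈ Finset.Icc 1 ⌊y⌋₊, cohenRamanujan β q n := by
    unfold momentC
    simp only [pow_one]
    rw [Finset.sum_comm, ← Finset.add_sum_Ioc_eq_sum_Icc hfloor]
    simp only [cohenRamanujan_one (by omega : β ≠ 0), Finset.sum_const, Nat.card_Icc, nsmul_eq_mul, mul_one,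
      Nat.add_sub_cancel]
    ring
  have hfl : ‖(⌊y⌋₊ : ℂ) - y‖ ≤ 1 := by
    rw [← Complex.ofReal_natCast, ← Complex.ofReal_sub, Complex.norm_real, Real.norm_eq_abs,
      abs_le]
    constructor <;> linarith [Nat.floor_le hy0.le, Nat.lt_floor_add_one y]
  have htail : ‖∑ q ∈ Finset.Ioc 1 ⌊x⌋₊, ∑ n ∈ Finset.Icc 1 ⌊y⌋₊, cohenRamanujan β q n‖
      ≤ x * (x ^ β * (2 * Real.log y)) := by
    refine (norm_sum_le _ _).trans ?_
    have hle : ∀ q ∈ Finset.Ioc 1 ⌊x⌋₊,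
        ‖∑ n ∈ Finset.Icc 1 ⌊y⌋₊, cohenRamanujan β q n‖ ≤ x ^ β * (2 * Real.log y) := by
      intro q hq
      rw [Finset.mem_Ioc] at hq
      have hqx : (q : ℝ) ≤ x := (Nat.le_floor_iff hx0.le).1 hq.2
      have hq1 : (1 : ℝ) ≤ q := by exact_mod_cast hq.1.le
      refine (norm_sum_cohenRamanujan_le (by omega) hq.1 _).trans ?_
      have hlq : Real.log q ≤ Real.log x := Real.log_le_log (by linarith) hqx
      have hlq0 : 0 ≤ Real.log q := Real.log_nonneg hq1
      have : 1 + β * Real.log q ≤ 2 * Real.log y := by nlinarith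
      gcongr
    refine (Finset.sum_le_card_nsmul _ _ _ hle).trans ?_
    rw [Nat.card_Ioc, nsmul_eq_mul]
    have : ((⌊x⌋₊ - 1 : ℕ) : ℝ) ≤ x :=
      le_trans (by exact_mod_cast Nat.sub_le _ _) (Nat.floor_le hx0.le)
    gcongr
  rw [hdecomp]
  refine (norm_add_le _ _).trans ?_
  nlinarith
end

section
/- Let β ∈ {1, 2}. There exists a constant C > 0 such that for all reals x ≥ 3 and y with x^{2β} < y < x^{2β+β²}(log x)^{(5/2)(β+1)} one has |C_{2,β}(x,y) − y·x^{1+β}/((1+β)ζ(1+β)) + x^{2+2β}/(2(1+β)²ζ(1+β)²)| ≤ C · ( y^{−1}x^{2+4β} + x^{2β+1}(log x + log log x) + x^{2β} y^{1/3 + 1/(6β)} (log y)^5 (log log y) ((log x)^4 + (log log x)^4) + y·x^{1/2+β}((log x)^3 + (log log x)^3) ). -/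
open Complex Finset
open scoped Classical

open ArithmeticFunction in
lemma sum_divisors_moebius_eq (n : ℕ) :
    ∑ d ∈ n.divisors, moebius d = if n = 1 then 1 else 0 := by
  rw [← coe_mul_zeta_apply, moebius_mul_coe_zeta, one_apply]

lemma sum_Icc_sum_divisorsAntidiagonal {M : Type*} [AddCommMonoid M] (N : ℕ) (f : ℕ → ℕ → M) :
    ∑ q ∈ Icc 1 N, ∑ p ∈ q.divisorsAntidiagonal, f p.1 p.2 =
      ∑ d ∈ Icc 1 N, ∑ m ∈ Icc 1 (N / d), f d m := by
  rw [Finset.sum_sigma', Finset.sum_sigma']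
  refine Finset.sum_bij' (fun a _ => ⟨a.2.1, a.2.2⟩) (fun b _ => ⟨b.1 * b.2, (b.1, b.2)⟩)
    ?_ ?_ ?_ ?_ ?_
  · rintro ⟨q, d, m⟩ h
    simp only [Finset.mem_sigma, Finset.mem_Icc, Nat.mem_divisorsAntidiagonal] at h ⊢
    obtain ⟨⟨h1, h2⟩, h3, h4⟩ := h
    have hd : d ≠ 0 := by rintro rfl; simp at h3; omega
    have hm : m ≠ 0 := by rintro rfl; simp at h3; omega
    refine ⟨⟨by omega, ?_⟩, by omega, ?_⟩
    · exact (Nat.le_mul_of_pos_right d (Nat.pos_of_ne_zero hm)).trans (h3 ▸ h2)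
    · rw [Nat.le_div_iff_mul_le (by omega)]
      rw [mul_comm]; omega
  · rintro ⟨d, m⟩ h
    simp only [Finset.mem_sigma, Finset.mem_Icc, Nat.mem_divisorsAntidiagonal] at h ⊢
    obtain ⟨⟨h1, h2⟩, h3, h4⟩ := h
    rw [Nat.le_div_iff_mul_le (by omega), mul_comm] at h4
    have : 0 < d * m := Nat.mul_pos (by omega) (by omega)
    exact ⟨⟨by omega, h4⟩, trivial, by omega⟩
  · rintro ⟨q, d, m⟩ h
    simp only [Finset.mem_sigma, Finset.mem_Icc, Nat.mem_divisorsAntidiagonal] at h ⊢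
    obtain ⟨⟨h1, h2⟩, rfl, h4⟩ := h
    rfl
  · rintro ⟨d, m⟩ h
    rfl
  · rintro ⟨q, d, m⟩ h
    rfl

lemma sum_Icc_ite_dvd {M : Type*} [AddCommMonoid M] (N k : ℕ) (hk : 0 < k) (f : ℕ → M) :
    ∑ c ∈ Icc 1 N, (if k ∣ c then f c else 0) = ∑ a ∈ Icc 1 (N / k), f (k * a) := by
  rw [← Finset.sum_filter]
  symm
  refine Finset.sum_nbij (fun a => k * a) ?_ ?_ ?_ ?_
  · intro a ha
    simp only [Finset.mem_Icc, Finset.mem_filter] at ha ⊢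
    rw [Nat.le_div_iff_mul_le hk, mul_comm] at ha
    exact ⟨⟨Nat.mul_pos hk ha.1, ha.2⟩, dvd_mul_right _ _⟩
  · intro a _ b _ h
    exact Nat.eq_of_mul_eq_mul_left hk h
  · intro c hc
    simp only [Finset.coe_filter, Finset.mem_Icc, Set.mem_ofPred_eq] at hc
    obtain ⟨⟨h1, h2⟩, a, rfl⟩ := hc
    refine ⟨a, ?_, rfl⟩
    simp only [Finset.coe_Icc, Set.mem_Icc]
    rw [Nat.le_div_iff_mul_le hk, mul_comm]
    exact ⟨Nat.pos_of_mul_pos_left h1, h2⟩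
  · intros; rfl

lemma exists_dvd_iff_pow_dvd (β : ℕ) (hβ : 0 < β) (G : ℕ) (hG : 0 < G) :
    ∃ D : ℕ, 0 < D ∧ ∀ d : ℕ, d ^ β ∣ G ↔ d ∣ D := by
  set S := (Icc 1 G).filter (fun d => d ^ β ∣ G) with hS
  have hmem : ∀ d, d ^ β ∣ G → d ∈ S := by
    intro d hd
    have h1 : d ≠ 0 := by
      rintro rfl
      rw [zero_pow hβ.ne'] at hd
      simp at hd; omega
    have h2 : d ≤ G := Nat.le_of_dvd hG ((dvd_pow_self d hβ.ne').trans hd)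
    simp [hS, hd, h2]; omega
  have hne : S.Nonempty := ⟨1, hmem 1 (by simp)⟩
  obtain ⟨D, hD, hmax⟩ := Finset.exists_max_image S id hne
  have hDG : D ^ β ∣ G := (Finset.mem_filter.1 hD).2
  have hD0 : 0 < D := (Finset.mem_Icc.1 (Finset.mem_filter.1 hD).1).1
  refine ⟨D, hD0, fun d => ⟨fun hd => ?_, fun hd => (pow_dvd_pow_of_dvd hd β).trans hDG⟩⟩
  have hl : (Nat.lcm d D) ^ β ∣ G := by
    rw [← Nat.pow_lcm_pow]
    exact Nat.lcm_dvd hd hDG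
  have h1 := hmax _ (hmem _ hl)
  have h2 : D ∣ Nat.lcm d D := Nat.dvd_lcm_right d D
  have h3 : 0 < Nat.lcm d D := (Finset.mem_Icc.1 (Finset.mem_filter.1 (hmem _ hl)).1).1
  have h4 : Nat.lcm d D = D := le_antisymm h1 (Nat.le_of_dvd h3 h2)
  exact h4 ▸ Nat.dvd_lcm_left d D

lemma sum_range_exp_two_pi (n Q : ℕ) (hQ : 0 < Q) :
    ∑ h ∈ range Q, Complex.exp (2 * Real.pi * Complex.I * n * h / Q) =
      if Q ∣ n then (Q : ℂ) else 0 := by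
  have hQ' : (Q : ℂ) ≠ 0 := by exact_mod_cast hQ.ne'
  set z : ℂ := Complex.exp (2 * Real.pi * Complex.I / Q) with hz
  have hprim : IsPrimitiveRoot z Q := Complex.isPrimitiveRoot_exp Q hQ.ne'
  have h1 : ∀ h ∈ range Q, Complex.exp (2 * Real.pi * Complex.I * n * h / Q) = (z ^ n) ^ h := by
    intro h _
    rw [hz, ← Complex.exp_nat_mul, ← Complex.exp_nat_mul]
    congr 1
    ring
  rw [Finset.sum_congr rfl h1]
  split_ifs with hd
  · rw [(hprim.pow_eq_one_iff_dvd n).2 hd]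
    simp
  · have hne : z ^ n ≠ 1 := fun h => hd ((hprim.pow_eq_one_iff_dvd n).1 h)
    rw [geom_sum_eq hne, ← pow_mul, mul_comm n Q, pow_mul, hprim.pow_eq_one]
    simp

lemma sum_range_filter_dvd_exp (n k Q : ℕ) (hk : 0 < k) (hQ : 0 < Q) :
    ∑ h ∈ range (k * Q), (if k ∣ h then
      Complex.exp (2 * Real.pi * Complex.I * n * h / (k * Q : ℕ)) else 0) =
      if Q ∣ n then (Q : ℂ) else 0 := by
  rw [← sum_range_exp_two_pi n Q hQ, ← Finset.sum_filter]
  symm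
  refine Finset.sum_nbij (fun a => k * a) ?_ ?_ ?_ ?_
  · intro a ha
    simp only [Finset.mem_range, Finset.mem_filter] at ha ⊢
    exact ⟨Nat.mul_lt_mul_of_pos_left ha hk, dvd_mul_right _ _⟩
  · intro a _ b _ h
    exact Nat.eq_of_mul_eq_mul_left hk h
  · intro c hc
    simp only [Finset.coe_filter, Finset.mem_range, Set.mem_ofPred_eq] at hc
    obtain ⟨h1, a, rfl⟩ := hc
    refine ⟨a, ?_, rfl⟩
    simpa using lt_of_mul_lt_mul_left h1 (Nat.zero_le k)
  · intro a _
    have hQ' : (Q : ℂ) ≠ 0 := by exact_mod_cast hQ.ne'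
    have hk' : (k : ℂ) ≠ 0 := by exact_mod_cast hk.ne'
    congr 1
    push_cast
    field_simp

lemma cohenRamanujan_eq (β q n : ℕ) (hβ : 0 < β) (hq : 0 < q) :
    cohenRamanujan β q n =
      ((∑ p ∈ q.divisorsAntidiagonal,
        (if p.1 ^ β ∣ n then (p.1 : ℤ) ^ β else 0) * ArithmeticFunction.moebius p.2 : ℤ) : ℂ) := by
  have hind : ∀ h : ℕ, (if ∀ d : ℕ, 1 < d → ¬(d ^ β ∣ h ∧ d ^ β ∣ q ^ β) then (1 : ℤ) else 0) =
      ∑ d ∈ q.divisors, if d ^ β ∣ h then ArithmeticFunction.moebius d else 0 := by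
    intro h
    obtain ⟨D, hD0, hD⟩ := exists_dvd_iff_pow_dvd β hβ (Nat.gcd h (q ^ β))
      (Nat.gcd_pos_of_pos_right _ (pow_pos hq β))
    simp only [Nat.dvd_gcd_iff] at hD
    have h1 : (∀ d : ℕ, 1 < d → ¬(d ^ β ∣ h ∧ d ^ β ∣ q ^ β)) ↔ D = 1 := by
      constructor
      · intro H
        by_contra hne
        exact H D (by omega) ((hD D).2 dvd_rfl)
      · rintro rfl d hd hh
        have := Nat.dvd_one.1 ((hD d).1 hh)
        omega
    rw [← Finset.sum_filter]
    have h2 : q.divisors.filter (fun d => d ^ β ∣ h) = D.divisors := by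
      ext d
      simp only [Finset.mem_filter, Nat.mem_divisors]
      rw [← hD, Nat.pow_dvd_pow_iff hβ.ne']
      constructor
      · rintro ⟨⟨a, b⟩, c⟩; exact ⟨⟨c, a⟩, hD0.ne'⟩
      · rintro ⟨⟨a, b⟩, c⟩; exact ⟨⟨b, hq.ne'⟩, a⟩
    rw [h2, sum_divisors_moebius_eq]
    simp only [h1]
  unfold cohenRamanujan
  rw [Finset.sum_filter]
  have h3 : ∀ h ∈ range (q ^ β),
      (if ∀ d : ℕ, 1 < d → ¬(d ^ β ∣ h ∧ d ^ β ∣ q ^ β) then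
        Complex.exp (2 * Real.pi * Complex.I * n * h / (q ^ β)) else 0) =
      ∑ p ∈ q.divisorsAntidiagonal, (ArithmeticFunction.moebius p.2 : ℂ) *
        (if p.2 ^ β ∣ h then Complex.exp (2 * Real.pi * Complex.I * n * h / (q ^ β)) else 0) := by
    intro h _
    have := congrArg (fun z : ℤ => (z : ℂ) *
      Complex.exp (2 * Real.pi * Complex.I * n * h / (q ^ β))) (hind h)
    rw [Nat.sum_divisorsAntidiagonal' (fun _ d => (ArithmeticFunction.moebius d : ℂ) *
        (if d ^ β ∣ h then Complex.exp (2 * Real.pi * Complex.I * n * h / (q ^ β)) else 0))]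
    simp only [Int.cast_ite, Int.cast_one, Int.cast_zero, ite_mul, one_mul, zero_mul,
      Int.cast_sum, Finset.sum_mul] at this
    rw [this]
    refine Finset.sum_congr rfl fun d _ => ?_
    split_ifs <;> simp
  rw [Finset.sum_congr rfl h3, Finset.sum_comm]
  push_cast
  refine Finset.sum_congr rfl fun p hp => ?_
  obtain ⟨hpq, -⟩ := Nat.mem_divisorsAntidiagonal.1 hp
  have h20 : 0 < p.2 := Nat.pos_of_ne_zero (by rintro h; simp [h] at hpq; omega)
  have h10 : 0 < p.1 := Nat.pos_of_ne_zero (by rintro h; simp [h] at hpq; omega)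
  have hqp : q ^ β = p.2 ^ β * p.1 ^ β := by rw [← mul_pow, mul_comm, hpq]
  rw [← Finset.mul_sum]
  have h4 := sum_range_filter_dvd_exp n (p.2 ^ β) (p.1 ^ β) (pow_pos h20 β) (pow_pos h10 β)
  rw [← hqp] at h4
  push_cast at h4
  rw [h4, mul_comm]

/-- The summatory function of the Möbius function. -/
noncomputable def mertensSum (n : ℕ) : ℝ := ∑ m ∈ Icc 1 n, (ArithmeticFunction.moebius m : ℝ)

/-- Jordan's totient function. -/
noncomputable def jordanTotient (β q : ℕ) : ℝ :=
  ∑ p ∈ q.divisorsAntidiagonal, (p.1 : ℝ) ^ β * (ArithmeticFunction.moebius p.2 : ℝ)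

/-- The summatory function of Jordan's totient function. -/
noncomputable def jordanSum (β N : ℕ) : ℝ := ∑ q ∈ Icc 1 N, jordanTotient β q

/-- The sawtooth function. -/
noncomputable def sawtooth (t : ℝ) : ℝ := Int.fract t - 1 / 2

/-- The sawtooth sum in the second moment of averages of Ramanujan sums. -/
noncomputable def sawtoothSum (β N : ℕ) (y : ℝ) : ℝ :=
  ∑ c ∈ Icc 1 N, ∑ d ∈ Icc 1 N, ((c : ℝ) ^ β * mertensSum (N / c)) *
    ((d : ℝ) ^ β * mertensSum (N / d)) * sawtooth (y / ((Nat.lcm c d : ℕ) : ℝ) ^ β)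

lemma sum_cohenRamanujan_eq (β N n : ℕ) (hβ : 0 < β) :
    ∑ q ∈ Icc 1 N, cohenRamanujan β q n =
      ((∑ d ∈ Icc 1 N, if d ^ β ∣ n then (d : ℝ) ^ β * mertensSum (N / d) else 0 : ℝ) : ℂ) := by
  have h1 : ∀ q ∈ Icc 1 N, cohenRamanujan β q n =
      ((∑ p ∈ q.divisorsAntidiagonal, (if p.1 ^ β ∣ n then (p.1 : ℝ) ^ β else 0) *
        (ArithmeticFunction.moebius p.2 : ℝ) : ℝ) : ℂ) := by
    intro q hq
    rw [cohenRamanujan_eq β q n hβ (Finset.mem_Icc.1 hq).1]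
    push_cast
    refine Finset.sum_congr rfl fun p _ => ?_
    split_ifs <;> simp
  rw [Finset.sum_congr rfl h1, ← Complex.ofReal_sum,
    sum_Icc_sum_divisorsAntidiagonal N (fun d m => (if d ^ β ∣ n then (d : ℝ) ^ β else 0) *
        (ArithmeticFunction.moebius m : ℝ))]
  congr 1
  refine Finset.sum_congr rfl fun d _ => ?_
  rw [← Finset.mul_sum, mertensSum]
  split_ifs <;> simp

lemma jordanSum_eq (β N : ℕ) :
    jordanSum β N = ∑ d ∈ Icc 1 N, (d : ℝ) ^ β * mertensSum (N / d) := by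
  unfold jordanSum jordanTotient
  rw [sum_Icc_sum_divisorsAntidiagonal N (fun d m => (d : ℝ) ^ β *
        (ArithmeticFunction.moebius m : ℝ))]
  simp only [mertensSum, Finset.mul_sum]

lemma jordanSum_eq' (β N : ℕ) :
    jordanSum β N = ∑ m ∈ Icc 1 N, (ArithmeticFunction.moebius m : ℝ) *
      ∑ k ∈ Icc 1 (N / m), (k : ℝ) ^ β := by
  unfold jordanSum jordanTotient
  have h : ∀ q ∈ Icc 1 N, ∑ p ∈ q.divisorsAntidiagonal, (p.1 : ℝ) ^ β *
      (ArithmeticFunction.moebius p.2 : ℝ) = ∑ p ∈ q.divisorsAntidiagonal,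
        (ArithmeticFunction.moebius p.1 : ℝ) * (p.2 : ℝ) ^ β := by
    intro q _
    rw [← Nat.map_swap_divisorsAntidiagonal, Finset.sum_map]
    simp [mul_comm]
  rw [Finset.sum_congr rfl h, sum_Icc_sum_divisorsAntidiagonal N (fun m k =>
        (ArithmeticFunction.moebius m : ℝ) * (k : ℝ) ^ β)]
  simp only [Finset.mul_sum]

lemma sum_mertensSum (n : ℕ) (hn : 0 < n) : ∑ a ∈ Icc 1 n, mertensSum (n / a) = 1 := by
  have h := sum_Icc_sum_divisorsAntidiagonal n
    (fun _ m => (ArithmeticFunction.moebius m : ℝ))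
  unfold mertensSum
  rw [← h]
  have h2 : ∀ q ∈ Icc 1 n, ∑ p ∈ q.divisorsAntidiagonal,
      (ArithmeticFunction.moebius p.2 : ℝ) = if q = 1 then 1 else 0 := by
    intro q _
    rw [Nat.sum_divisorsAntidiagonal' (fun _ m => (ArithmeticFunction.moebius m : ℝ))]
    exact_mod_cast sum_divisors_moebius_eq q
  rw [Finset.sum_congr rfl h2, Finset.sum_ite_eq']
  simp; omega

lemma sum_divisors_jordanTotient (β n : ℕ) (hn : 0 < n) :
    ∑ k ∈ n.divisors, jordanTotient β k = (n : ℝ) ^ β := by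
  have := (ArithmeticFunction.sum_eq_iff_sum_mul_moebius_eq (R := ℝ) (f := jordanTotient β)
    (g := fun n => (n : ℝ) ^ β)).2 (fun q _ => by
      unfold jordanTotient
      rw [← Nat.map_swap_divisorsAntidiagonal, Finset.sum_map]
      simp [mul_comm])
  exact this n hn

lemma sum_mertensSum_mul_gcd_pow (β N : ℕ) :
    ∑ c ∈ Icc 1 N, ∑ d ∈ Icc 1 N, mertensSum (N / c) * mertensSum (N / d) *
      ((Nat.gcd c d : ℕ) : ℝ) ^ β = jordanSum β N := by
  have h1 : ∀ c ∈ Icc 1 N, ∀ d ∈ Icc 1 N, mertensSum (N / c) * mertensSum (N / d) *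
      ((Nat.gcd c d : ℕ) : ℝ) ^ β = ∑ k ∈ Icc 1 N, jordanTotient β k *
        ((if k ∣ c then mertensSum (N / c) else 0) * (if k ∣ d then mertensSum (N / d) else 0)) := by
    intro c hc d hd
    rw [Finset.mem_Icc] at hc hd
    have hg : 0 < Nat.gcd c d := Nat.gcd_pos_of_pos_left _ hc.1
    rw [← sum_divisors_jordanTotient β _ hg, Finset.mul_sum]
    have hs : (Nat.gcd c d).divisors ⊆ Icc 1 N := by
      intro k hk
      rw [Nat.mem_divisors] at hk
      rw [Finset.mem_Icc]
      exact ⟨Nat.pos_of_dvd_of_pos hk.1 hg,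
        (Nat.le_of_dvd hc.1 (hk.1.trans (Nat.gcd_dvd_left c d))).trans hc.2⟩
    rw [← Finset.sum_subset hs]
    · refine Finset.sum_congr rfl fun k hk => ?_
      have hk' := (Nat.mem_divisors.1 hk).1
      rw [if_pos (hk'.trans (Nat.gcd_dvd_left c d)), if_pos (hk'.trans (Nat.gcd_dvd_right c d))]
      ring
    · intro k _ hk
      have : ¬ (k ∣ c ∧ k ∣ d) := fun h =>
        hk (Nat.mem_divisors.2 ⟨Nat.dvd_gcd h.1 h.2, hg.ne'⟩)
      by_cases hkc : k ∣ c
      · rw [if_neg (fun h => this ⟨hkc, h⟩)]; simp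
      · rw [if_neg hkc]; simp
  rw [Finset.sum_congr rfl fun c hc => Finset.sum_congr rfl (h1 c hc)]
  rw [Finset.sum_congr rfl fun c _ => Finset.sum_comm, Finset.sum_comm]
  unfold jordanSum
  refine Finset.sum_congr rfl fun k hk => ?_
  rw [Finset.mem_Icc] at hk
  simp only [← Finset.mul_sum]
  rw [← Finset.sum_mul, sum_Icc_ite_dvd N k (by omega) (fun c => mertensSum (N / c))]
  simp only [← Nat.div_div_eq_div_mul]
  rw [sum_mertensSum _ (Nat.div_pos hk.2 (by omega))]
  ring

lemma card_filter_dvd_and_dvd (y : ℝ) (hy : 0 ≤ y) (a b : ℕ) :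
    (((Icc 1 ⌊y⌋₊).filter (fun n => a ∣ n ∧ b ∣ n)).card : ℝ) =
      y / (Nat.lcm a b : ℕ) - 1 / 2 - sawtooth (y / (Nat.lcm a b : ℕ)) := by
  have h1 : ((Icc 1 ⌊y⌋₊).filter (fun n => a ∣ n ∧ b ∣ n)).card = ⌊y⌋₊ / Nat.lcm a b := by
    rw [← Nat.Ioc_filter_dvd_card_eq_div]
    congr 1
    ext n
    simp [Nat.lcm_dvd_iff, Finset.mem_Icc, Finset.mem_Ioc, Nat.succ_le_iff]
  rw [h1, ← Nat.floor_div_natCast, sawtooth, Int.fract, natCast_floor_eq_intCast_floor (by positivity)]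
  ring

lemma momentC_two_eq (β : ℕ) (hβ : 0 < β) (x y : ℝ) (hy : 0 ≤ y) :
    momentC 2 β x y = ((y * jordanSum β ⌊x⌋₊ - (jordanSum β ⌊x⌋₊) ^ 2 / 2
      - sawtoothSum β ⌊x⌋₊ y : ℝ) : ℂ) := by
  unfold momentC
  set N := ⌊x⌋₊
  simp only [sum_cohenRamanujan_eq β N _ hβ, ← Complex.ofReal_pow, ← Complex.ofReal_sum]
  congr 1
  set w : ℕ → ℝ := fun d => (d : ℝ) ^ β * mertensSum (N / d) with hw
  have h1 : ∀ n ∈ Icc 1 ⌊y⌋₊, (∑ d ∈ Icc 1 N, if d ^ β ∣ n then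
      (d : ℝ) ^ β * mertensSum (N / d) else 0) ^ 2 =
      ∑ c ∈ Icc 1 N, ∑ d ∈ Icc 1 N, w c * w d * (if c ^ β ∣ n ∧ d ^ β ∣ n then 1 else 0) := by
    intro n _
    rw [sq, Finset.sum_mul_sum]
    refine Finset.sum_congr rfl fun c _ => Finset.sum_congr rfl fun d _ => ?_
    by_cases h1 : c ^ β ∣ n <;> by_cases h2 : d ^ β ∣ n <;> simp [h1, h2, hw]
  rw [Finset.sum_congr rfl h1, Finset.sum_comm, Finset.sum_congr rfl fun c _ => Finset.sum_comm]
  simp only [← Finset.mul_sum, Finset.sum_boole, card_filter_dvd_and_dvd y hy]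
  rw [jordanSum_eq, sq, Finset.sum_mul_sum, ← jordanSum_eq, ← sum_mertensSum_mul_gcd_pow,
    sawtoothSum, Finset.mul_sum, Finset.sum_div, ← Finset.sum_sub_distrib,
    ← Finset.sum_sub_distrib]
  refine Finset.sum_congr rfl fun c hc => ?_
  rw [Finset.mul_sum, Finset.sum_div, ← Finset.sum_sub_distrib, ← Finset.sum_sub_distrib]
  refine Finset.sum_congr rfl fun d hd => ?_
  rw [Finset.mem_Icc] at hc hd
  have hl : (Nat.gcd c d : ℝ) * (Nat.lcm c d : ℝ) = c * d := by exact_mod_cast Nat.gcd_mul_lcm c d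
  have hl0 : (Nat.lcm c d : ℝ) ≠ 0 := by
    exact_mod_cast (Nat.lcm_pos hc.1 hd.1).ne'
  have key : (c : ℝ) ^ β * (d : ℝ) ^ β * (y / (Nat.lcm c d : ℝ) ^ β) =
      y * (Nat.gcd c d : ℝ) ^ β := by
    rw [← mul_pow, ← hl, mul_pow]
    field_simp
  rw [Nat.pow_lcm_pow]
  push_cast
  simp only [hw]
  linear_combination (mertensSum (N / c) * mertensSum (N / d)) * key

lemma one_le_log_of_three_le {x : ℝ} (hx : 3 ≤ x) : 1 ≤ Real.log x := by
  rw [Real.le_log_iff_exp_le (by linarith)]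
  linarith [Real.exp_one_lt_d9]

lemma abs_moebius_cast_le_one (m : ℕ) : |(ArithmeticFunction.moebius m : ℝ)| ≤ 1 := by
  exact_mod_cast ArithmeticFunction.abs_moebius_le_one (n := m)

lemma abs_mertensSum_le (n : ℕ) : |mertensSum n| ≤ n := by
  unfold mertensSum
  refine (Finset.abs_sum_le_sum_abs _ _).trans ?_
  refine (Finset.sum_le_sum fun m _ => abs_moebius_cast_le_one m).trans ?_
  simp

lemma sum_Icc_inv_le_one_add_log (N : ℕ) :
    ∑ m ∈ Icc 1 N, (m : ℝ)⁻¹ ≤ 1 + Real.log N := by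
  have h := harmonic_le_one_add_log N
  rw [harmonic_eq_sum_Icc] at h
  push_cast at h
  exact h

lemma abs_sum_Icc_pow_sub_le (β : ℕ) (hβ : β = 1 ∨ β = 2) (t : ℝ) (ht : 1 ≤ t) :
    |∑ k ∈ Icc 1 ⌊t⌋₊, (k : ℝ) ^ β - t ^ (1 + β) / (1 + β)| ≤ t ^ β := by
  have h1 : ∀ K : ℕ, ∑ k ∈ Icc 1 K, (k : ℝ) = K * (K + 1) / 2 := by
    intro K
    induction K with
    | zero => simp
    | succ n ih => rw [Finset.sum_Icc_succ_top (by omega), ih]; push_cast; ring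
  have h2 : ∀ K : ℕ, ∑ k ∈ Icc 1 K, (k : ℝ) ^ 2 = K * (K + 1) * (2 * K + 1) / 6 := by
    intro K
    induction K with
    | zero => simp
    | succ n ih => rw [Finset.sum_Icc_succ_top (by omega), ih]; push_cast; ring
  have hK1 : (⌊t⌋₊ : ℝ) ≤ t := Nat.floor_le (by linarith)
  have hK2 : t < ⌊t⌋₊ + 1 := Nat.lt_floor_add_one t
  have hK0 : (1 : ℝ) ≤ ⌊t⌋₊ := by exact_mod_cast Nat.le_floor (by simpa using ht)
  set K : ℝ := (⌊t⌋₊ : ℝ)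
  rcases hβ with rfl | rfl
  · simp only [pow_one, h1]
    rw [abs_le]
    push_cast
    constructor <;> nlinarith
  · rw [h2, abs_le]
    have a1 : K * (K + 1) * (2 * K + 1) ≤ t * (t + 1) * (2 * t + 1) := by gcongr
    have a2 : (t - 1) * t * (2 * t - 1) ≤ K * (K + 1) * (2 * K + 1) := by
      gcongr <;> linarith
    push_cast
    constructor <;> nlinarith

/-- The Dirichlet series of the Möbius function at `β + 1`, as a real number. -/
noncomputable def moebiusSeries (β : ℕ) : ℝ :=
  ∑' m : ℕ, (ArithmeticFunction.moebius m : ℝ) / (m : ℝ) ^ (1 + β)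

lemma zeta_mul_moebiusSeries (β : ℕ) (hβ : 0 < β) :
    riemannZeta (1 + (β : ℂ)) * (moebiusSeries β : ℂ) = 1 := by
  have hs : 1 < (1 + (β : ℂ)).re := by simp; omega
  have h := ArithmeticFunction.LSeries_zeta_mul_Lseries_moebius hs
  rw [ArithmeticFunction.LSeries_zeta_eq_riemannZeta hs] at h
  refine Eq.trans (congrArg (riemannZeta (1 + (β : ℂ)) * ·) ?_) h
  simp only [moebiusSeries, LSeries, Complex.ofReal_tsum]
  refine tsum_congr fun m => ?_
  rcases eq_or_ne m 0 with rfl | hm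
  · simp
  · rw [LSeries.term_of_ne_zero hm]
    have : (1 + (β : ℂ)) = ((1 + β : ℕ) : ℂ) := by push_cast; ring
    rw [this, Complex.cpow_natCast]
    push_cast
    rfl

lemma abs_moebius_div_pow_le (β : ℕ) (hβ : 0 < β) (m : ℕ) :
    |(ArithmeticFunction.moebius m : ℝ) / (m : ℝ) ^ (1 + β)| ≤ ((m : ℝ) ^ 2)⁻¹ := by
  rcases Nat.eq_zero_or_pos m with rfl | hm
  · simp
  have hm' : (1 : ℝ) ≤ m := by exact_mod_cast hm
  rw [abs_div, abs_of_nonneg (by positivity : (0 : ℝ) ≤ (m : ℝ) ^ (1 + β)), div_eq_mul_inv]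
  calc _ ≤ 1 * ((m : ℝ) ^ (1 + β))⁻¹ := by gcongr; exact abs_moebius_cast_le_one m
    _ ≤ _ := by rw [one_mul]; gcongr; omega

lemma abs_moebiusSeries_sub_le (β : ℕ) (hβ : 0 < β) (N : ℕ) :
    |∑ m ∈ Icc 1 N, (ArithmeticFunction.moebius m : ℝ) / (m : ℝ) ^ (1 + β) - moebiusSeries β| ≤
      2 / (N + 1) := by
  set f : ℕ → ℝ := fun m => (ArithmeticFunction.moebius m : ℝ) / (m : ℝ) ^ (1 + β) with hf
  have hsum : Summable f := by
    refine Summable.of_norm_bounded (g := fun m : ℕ => ((m : ℝ) ^ 2)⁻¹) ?_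
      (fun m => abs_moebius_div_pow_le β hβ m)
    exact Real.summable_nat_pow_inv.2 (by norm_num)
  have h0 : ∑ m ∈ Icc 1 N, f m = ∑ m ∈ range (N + 1), f m := by
    rw [Finset.range_eq_Ico, Finset.sum_eq_sum_Ico_succ_bot (by omega)]
    simp [hf]
    rfl
  have ht : Filter.Tendsto (fun M => ∑ m ∈ range M, f m) Filter.atTop (nhds (moebiusSeries β)) :=
    hsum.hasSum.tendsto_sum_nat
  have ht2 := ((ht.const_sub (∑ m ∈ Icc 1 N, f m)).abs)
  refine le_of_tendsto ht2 ?_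
  filter_upwards [Filter.eventually_ge_atTop (N + 1)] with M hM
  rw [h0, abs_sub_comm, ← Finset.sum_Ico_eq_sub _ hM]
  refine (Finset.abs_sum_le_sum_abs _ _).trans ?_
  refine (Finset.sum_le_sum fun m _ => abs_moebius_div_pow_le β hβ m).trans ?_
  exact sum_Ioo_inv_sq_le N M

lemma abs_jordanSum_sub_le (β : ℕ) (hβ : β = 1 ∨ β = 2) (x : ℝ) (hx : 3 ≤ x) :
    |jordanSum β ⌊x⌋₊ - x ^ (1 + β) / (1 + β) * moebiusSeries β| ≤ 4 * x ^ β * Real.log x := by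
  have hβ0 : 0 < β := by omega
  have hlog := one_le_log_of_three_le hx
  set N := ⌊x⌋₊ with hN
  have hNx : (N : ℝ) ≤ x := Nat.floor_le (by linarith)
  have hxN : x < N + 1 := Nat.lt_floor_add_one x
  have hN1 : (1 : ℝ) ≤ N := by
    have : 1 ≤ N := Nat.le_floor (by push_cast; linarith)
    exact_mod_cast this
  have h1 : |jordanSum β N - x ^ (1 + β) / (1 + β) *
      ∑ m ∈ Icc 1 N, (ArithmeticFunction.moebius m : ℝ) / (m : ℝ) ^ (1 + β)| ≤
      2 * x ^ β * Real.log x := by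
    rw [jordanSum_eq', Finset.mul_sum, ← Finset.sum_sub_distrib]
    refine (Finset.abs_sum_le_sum_abs _ _).trans ?_
    have hterm : ∀ m ∈ Icc 1 N, |(ArithmeticFunction.moebius m : ℝ) *
        ∑ k ∈ Icc 1 (N / m), (k : ℝ) ^ β -
        x ^ (1 + β) / (1 + β) * ((ArithmeticFunction.moebius m : ℝ) / (m : ℝ) ^ (1 + β))| ≤
        x ^ β * (m : ℝ)⁻¹ := by
      intro m hm
      rw [Finset.mem_Icc] at hm
      have hm1 : (1 : ℝ) ≤ m := by exact_mod_cast hm.1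
      have hmN : (m : ℝ) ≤ N := by exact_mod_cast hm.2
      have ht : 1 ≤ x / m := by rw [le_div_iff₀ (by linarith)]; linarith
      have hb := abs_sum_Icc_pow_sub_le β hβ (x / m) ht
      rw [Nat.floor_div_natCast] at hb
      have : (ArithmeticFunction.moebius m : ℝ) * ∑ k ∈ Icc 1 (N / m), (k : ℝ) ^ β -
        x ^ (1 + β) / (1 + β) * ((ArithmeticFunction.moebius m : ℝ) / (m : ℝ) ^ (1 + β)) =
        (ArithmeticFunction.moebius m : ℝ) * (∑ k ∈ Icc 1 (N / m), (k : ℝ) ^ β -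
          (x / m) ^ (1 + β) / (1 + β)) := by
        rw [div_pow]; ring
      rw [this, abs_mul]
      calc _ ≤ 1 * (x / m) ^ β := by
            gcongr
            exact abs_moebius_cast_le_one m
        _ = x ^ β * ((m : ℝ) ^ β)⁻¹ := by rw [div_pow]; ring
        _ ≤ x ^ β * (m : ℝ)⁻¹ := by
            gcongr
            exact le_self_pow₀ hm1 (by omega)
    refine (Finset.sum_le_sum hterm).trans ?_
    rw [← Finset.mul_sum]
    have h2 := sum_Icc_inv_le_one_add_log N
    have h3 : Real.log N ≤ Real.log x := Real.log_le_log (by linarith) hNx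
    have : x ^ β * ∑ m ∈ Icc 1 N, (m : ℝ)⁻¹ ≤ x ^ β * (2 * Real.log x) := by
      gcongr; linarith
    linarith
  have h2 := abs_moebiusSeries_sub_le β hβ0 N
  have h3 : |x ^ (1 + β) / (1 + β) * (∑ m ∈ Icc 1 N, (ArithmeticFunction.moebius m : ℝ) /
      (m : ℝ) ^ (1 + β) - moebiusSeries β)| ≤ 2 * x ^ β * Real.log x := by
    rw [abs_mul, abs_of_nonneg (by positivity)]
    have hβ1 : (1 : ℝ) ≤ 1 + β := by linarith [Nat.cast_nonneg (α := ℝ) β]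
    calc _ ≤ x ^ (1 + β) / 1 * (2 / x) := by
          gcongr
          exact h2.trans (by gcongr)
      _ = 2 * x ^ β := by rw [pow_add]; field_simp
      _ ≤ _ := le_mul_of_one_le_right (by positivity) hlog
  have := abs_add_le _ _ |>.trans (add_le_add h1 h3)
  rw [show ∀ a b c d : ℝ, a - b * c + b * (c - d) = a - b * d from fun a b c d => by ring] at this
  linarith

lemma sum_abs_pow_mul_mertensSum_le (β N : ℕ) (hβ : 0 < β) :
    ∑ d ∈ Icc 1 N, |(d : ℝ) ^ β * mertensSum (N / d)| ≤ (N : ℝ) ^ (1 + β) := by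
  have h : ∀ d ∈ Icc 1 N, |(d : ℝ) ^ β * mertensSum (N / d)| ≤ (N : ℝ) ^ β := by
    intro d hd
    rw [Finset.mem_Icc] at hd
    have hd1 : (0 : ℝ) < d := by exact_mod_cast hd.1
    have hdN : (d : ℝ) ≤ N := by exact_mod_cast hd.2
    obtain ⟨γ, rfl⟩ : ∃ γ, β = γ + 1 := ⟨β - 1, by omega⟩
    rw [abs_mul, abs_of_nonneg (by positivity)]
    calc _ ≤ (d : ℝ) ^ (γ + 1) * ((N : ℝ) / d) := by
          gcongr
          exact (abs_mertensSum_le _).trans Nat.cast_div_le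
      _ = (d : ℝ) ^ γ * N := by rw [pow_succ]; field_simp
      _ ≤ (N : ℝ) ^ γ * N := by gcongr
      _ = _ := by rw [pow_succ]
  refine (Finset.sum_le_sum h).trans ?_
  simp [pow_add]

lemma abs_jordanSum_le (β N : ℕ) (hβ : 0 < β) : |jordanSum β N| ≤ (N : ℝ) ^ (1 + β) := by
  rw [jordanSum_eq]
  exact (Finset.abs_sum_le_sum_abs _ _).trans (sum_abs_pow_mul_mertensSum_le β N hβ)

lemma abs_sawtooth_le (t : ℝ) : |sawtooth t| ≤ 1 / 2 := by
  unfold sawtooth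
  rw [abs_le]
  constructor <;> linarith [Int.fract_nonneg t, Int.fract_lt_one t]

lemma abs_sawtoothSum_le (β N : ℕ) (hβ : 0 < β) (y : ℝ) :
    |sawtoothSum β N y| ≤ ((N : ℝ) ^ (1 + β)) ^ 2 := by
  unfold sawtoothSum
  have h := sum_abs_pow_mul_mertensSum_le β N hβ
  calc _ ≤ ∑ c ∈ Icc 1 N, ∑ d ∈ Icc 1 N, |(c : ℝ) ^ β * mertensSum (N / c)| *
        |(d : ℝ) ^ β * mertensSum (N / d)| := by
        refine (Finset.abs_sum_le_sum_abs _ _).trans (Finset.sum_le_sum fun c _ => ?_)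
        refine (Finset.abs_sum_le_sum_abs _ _).trans (Finset.sum_le_sum fun d _ => ?_)
        rw [abs_mul, abs_mul]
        refine mul_le_of_le_one_right (by positivity) ?_
        linarith [abs_sawtooth_le (y / ((Nat.lcm c d : ℕ) : ℝ) ^ β)]
    _ = (∑ d ∈ Icc 1 N, |(d : ℝ) ^ β * mertensSum (N / d)|) ^ 2 := by
        rw [sq, Finset.sum_mul_sum]
    _ ≤ _ := by gcongr

/-- The periodic antiderivative of the sawtooth function vanishing at the integers. -/
noncomputable def sawtoothPrimitive (t : ℝ) : ℝ := (Int.fract t ^ 2 - Int.fract t) / 2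

lemma abs_sawtoothPrimitive_le (t : ℝ) : |sawtoothPrimitive t| ≤ 1 / 8 := by
  unfold sawtoothPrimitive
  have h0 := Int.fract_nonneg t
  have h1 := Int.fract_lt_one t
  rw [abs_le]
  constructor <;> nlinarith [sq_nonneg (Int.fract t - 1 / 2)]

lemma abs_sawtoothPrimitive_sub_le {s t : ℝ} (h : s ≤ t) :
    |sawtoothPrimitive t - sawtoothPrimitive s - sawtooth t * (t - s)| ≤
      (t - s) * ((t - s) + ((⌊t⌋ : ℝ) - ⌊s⌋)) := by
  have ht : t = ⌊t⌋ + Int.fract t := (Int.floor_add_fract t).symm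
  have hs : s = ⌊s⌋ + Int.fract s := (Int.floor_add_fract s).symm
  have hmono : ⌊s⌋ ≤ ⌊t⌋ := Int.floor_mono h
  have ht0 := Int.fract_nonneg t
  have ht1 := Int.fract_lt_one t
  have hs0 := Int.fract_nonneg s
  have hs1 := Int.fract_lt_one s
  unfold sawtoothPrimitive sawtooth
  set u := Int.fract t
  set v := Int.fract s
  rcases hmono.eq_or_lt with heq | hlt
  · rw [← heq] at ht ⊢
    have hd : t - s = u - v := by linarith
    have hd0 : 0 ≤ u - v := by linarith
    rw [hd, abs_le]
    constructor <;> nlinarith [sq_nonneg (u - v)]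
  · have hn : (1 : ℝ) ≤ (⌊t⌋ : ℝ) - ⌊s⌋ := by
      have : (⌊s⌋ : ℝ) + 1 ≤ ⌊t⌋ := by exact_mod_cast hlt
      linarith
    set n : ℝ := (⌊t⌋ : ℝ) - ⌊s⌋
    have hd : u + (1 - v) ≤ t - s := by linarith
    have hd0 : 0 ≤ t - s := by linarith
    have hF : |(u ^ 2 - u) / 2 - (v ^ 2 - v) / 2| ≤ (t - s) / 2 := by
      rw [abs_le]
      constructor <;> nlinarith
    have hS : |(u - 1 / 2) * (t - s)| ≤ (t - s) / 2 := by
      rw [abs_le]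
      constructor <;> nlinarith
    have := abs_sub ((u ^ 2 - u) / 2 - (v ^ 2 - v) / 2) ((u - 1 / 2) * (t - s))
    nlinarith

lemma sum_Ioc_sub_succ (h : ℕ → ℝ) {R B : ℕ} (hRB : R ≤ B) :
    ∑ a ∈ Ioc R B, (h a - h (a + 1)) = h (R + 1) - h (B + 1) := by
  induction B, hRB using Nat.le_induction with
  | base => simp
  | succ n hn ih => rw [Finset.sum_Ioc_succ_top (by omega), ih]; ring

lemma abs_sum_Ioc_mul_sub_succ_le (p f : ℕ → ℝ) (c : ℝ) {R B : ℕ} (hRB : R ≤ B)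
    (hp : Monotone p) (hp0 : ∀ a, 0 ≤ p a) (hf : ∀ a, |f a| ≤ c) :
    |∑ a ∈ Ioc R B, p a * (f a - f (a + 1))| ≤ 2 * (p B * c) := by
  have key : |∑ a ∈ Ioc R B, p a * (f a - f (a + 1)) + p B * f (B + 1)| ≤ p B * c := by
    induction B, hRB using Nat.le_induction with
    | base =>
      simp only [Finset.Ioc_self, Finset.sum_empty, zero_add]
      rw [abs_mul, abs_of_nonneg (hp0 R)]
      exact mul_le_mul_of_nonneg_left (hf _) (hp0 R)
    | succ n hn ih =>
      rw [Finset.sum_Ioc_succ_top (by omega)]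
      have e : ∑ a ∈ Ioc R n, p a * (f a - f (a + 1)) + p (n + 1) * (f (n + 1) - f (n + 1 + 1)) +
          p (n + 1) * f (n + 1 + 1) =
          (∑ a ∈ Ioc R n, p a * (f a - f (a + 1)) + p n * f (n + 1)) +
            (p (n + 1) - p n) * f (n + 1) := by ring
      rw [e]
      have h0 : 0 ≤ p (n + 1) - p n := sub_nonneg.2 (hp (by omega))
      refine (abs_add_le _ _).trans ?_
      rw [abs_mul, abs_of_nonneg h0]
      have := mul_le_mul_of_nonneg_left (hf (n + 1)) h0
      linarith
  have h2 : |p B * f (B + 1)| ≤ p B * c := by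
    rw [abs_mul, abs_of_nonneg (hp0 B)]
    exact mul_le_mul_of_nonneg_left (hf _) (hp0 B)
  have := abs_sub (∑ a ∈ Ioc R B, p a * (f a - f (a + 1)) + p B * f (B + 1)) (p B * f (B + 1))
  rw [add_sub_cancel_right] at this
  linarith

lemma abs_sum_Ioc_mul_sawtooth_le (Y : ℝ) (hY : 0 < Y) {R B : ℕ} (hRB : R < B) :
    |∑ a ∈ Ioc R B, (a : ℝ) * sawtooth (Y / a)| ≤
      (B : ℝ) ^ 3 / Y + 2 * B * (Y / (R + 1)) := by
  set p : ℕ → ℝ := fun a => (a : ℝ) ^ 2 * (a + 1) / Y with hp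
  set f : ℕ → ℝ := fun a => sawtoothPrimitive (Y / a) with hf
  set h : ℕ → ℝ := fun a => Y / a + ⌊Y / (a : ℝ)⌋ with hh
  have hB1 : (1 : ℝ) ≤ B := by exact_mod_cast (by omega : 1 ≤ B)
  have h1 : |∑ a ∈ Ioc R B, p a * (f a - f (a + 1))| ≤ 2 * (p B * (1 / 8)) := by
    refine abs_sum_Ioc_mul_sub_succ_le p f _ hRB.le ?_ ?_ ?_
    · intro a b hab
      have : (a : ℝ) ≤ b := by exact_mod_cast hab
      simp only [hp]
      gcongr
    · intro a; simp only [hp]; positivity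
    · intro a; exact abs_sawtoothPrimitive_le _
  have h2 : |∑ a ∈ Ioc R B, p a * (f a - f (a + 1)) - ∑ a ∈ Ioc R B, (a : ℝ) * sawtooth (Y / a)|
      ≤ B * (h (R + 1) - h (B + 1)) := by
    rw [← Finset.sum_sub_distrib, ← sum_Ioc_sub_succ h hRB.le, Finset.mul_sum]
    refine (Finset.abs_sum_le_sum_abs _ _).trans (Finset.sum_le_sum fun a ha => ?_)
    rw [Finset.mem_Ioc] at ha
    have ha0 : (0 : ℝ) < a := by exact_mod_cast (by omega : 0 < a)
    have haB : (a : ℝ) ≤ B := by exact_mod_cast ha.2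
    have hle : Y / (a + 1) ≤ Y / a := by gcongr; linarith
    have hfl : (⌊Y / ((a : ℝ) + 1)⌋ : ℝ) ≤ ⌊Y / (a : ℝ)⌋ := by exact_mod_cast Int.floor_mono hle
    have hs := abs_sawtoothPrimitive_sub_le hle
    have hpa : p a * (Y / a - Y / (a + 1)) = a := by
      simp only [hp]; field_simp; ring
    have hpa0 : 0 < p a := by simp only [hp]; positivity
    have e : p a * (f a - f (a + 1)) - a * sawtooth (Y / a) =
        p a * (sawtoothPrimitive (Y / a) - sawtoothPrimitive (Y / (a + 1)) -
          sawtooth (Y / a) * (Y / a - Y / (a + 1))) := by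
      simp only [hf]
      push_cast
      linear_combination (- sawtooth (Y / a)) * (-hpa)
    rw [e, abs_mul, abs_of_pos hpa0]
    calc _ ≤ p a * ((Y / a - Y / (a + 1)) * ((Y / a - Y / (a + 1)) +
          ((⌊Y / (a : ℝ)⌋ : ℝ) - ⌊Y / ((a : ℝ) + 1)⌋))) := by gcongr
      _ = a * ((Y / a - Y / (a + 1)) + ((⌊Y / (a : ℝ)⌋ : ℝ) - ⌊Y / ((a : ℝ) + 1)⌋)) := by
          rw [← mul_assoc, hpa]
      _ ≤ B * ((Y / a - Y / (a + 1)) + ((⌊Y / (a : ℝ)⌋ : ℝ) - ⌊Y / ((a : ℝ) + 1)⌋)) := by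
          gcongr
      _ = _ := by simp only [hh]; push_cast; ring
  have h3 : h (R + 1) - h (B + 1) ≤ 2 * (Y / (R + 1)) := by
    simp only [hh]
    push_cast
    have a1 : (⌊Y / ((R : ℝ) + 1)⌋ : ℝ) ≤ Y / (R + 1) := Int.floor_le _
    have a2 : (0 : ℝ) ≤ (⌊Y / ((B : ℝ) + 1)⌋ : ℝ) := by
      exact_mod_cast Int.floor_nonneg.2 (by positivity)
    have a3 : 0 ≤ Y / ((B : ℝ) + 1) := by positivity
    linarith
  have h4 : p B ≤ 2 * ((B : ℝ) ^ 3 / Y) := by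
    simp only [hp]
    rw [← mul_div_assoc]
    refine div_le_div_of_nonneg_right ?_ hY.le
    nlinarith [mul_le_mul_of_nonneg_left hB1 (sq_nonneg (B : ℝ))]
  have h5 : (B : ℝ) * (h (R + 1) - h (B + 1)) ≤ B * (2 * (Y / (R + 1))) := by gcongr
  have h6 : 0 ≤ (B : ℝ) ^ 3 / Y := by positivity
  rw [abs_le] at h1 h2 ⊢
  constructor <;> linarith [h1.1, h1.2, h2.1, h2.2]

lemma abs_sum_Icc_mul_sawtooth_le_sq (Y : ℝ) (B : ℕ) :
    |∑ a ∈ Icc 1 B, (a : ℝ) * sawtooth (Y / a)| ≤ (B : ℝ) * B := by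
  refine (Finset.abs_sum_le_sum_abs _ _).trans ?_
  calc _ ≤ ∑ _a ∈ Icc 1 B, (B : ℝ) := by
        refine Finset.sum_le_sum fun a ha => ?_
        have haB : (a : ℝ) ≤ B := by exact_mod_cast (Finset.mem_Icc.1 ha).2
        rw [abs_mul, Nat.abs_cast]
        have := abs_sawtooth_le (Y / a)
        nlinarith [abs_nonneg (sawtooth (Y / a)), Nat.cast_nonneg (α := ℝ) a]
    _ = _ := by simp

lemma abs_sum_Icc_mul_sawtooth_le (Y : ℝ) (hY : 1 ≤ Y) (B : ℕ) :
    |∑ a ∈ Icc 1 B, (a : ℝ) * sawtooth (Y / a)| ≤ 3 * ((B : ℝ) ^ 3 / Y + B * √Y) := by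
  set R := ⌊√Y⌋₊
  have hY0 : 0 < Y := by linarith
  have hR1 : (R : ℝ) ≤ √Y := Nat.floor_le (Real.sqrt_nonneg _)
  have hR2 : √Y < R + 1 := Nat.lt_floor_add_one _
  have hpos : 0 ≤ (B : ℝ) ^ 3 / Y := by positivity
  have hpos2 : 0 ≤ (B : ℝ) * √Y := by positivity
  rcases le_or_gt B R with h | h
  · have hB : (B : ℝ) ≤ √Y := le_trans (by exact_mod_cast h) hR1
    have h1 := abs_sum_Icc_mul_sawtooth_le_sq Y B
    have h2 : (B : ℝ) * B ≤ B * √Y := by gcongr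
    linarith
  · have hBR : (R : ℝ) ≤ B := by exact_mod_cast h.le
    have e : ∑ a ∈ Icc 1 B, (a : ℝ) * sawtooth (Y / a) =
        ∑ a ∈ Icc 1 R, (a : ℝ) * sawtooth (Y / a) + ∑ a ∈ Ioc R B, (a : ℝ) * sawtooth (Y / a) := by
      rw [show Icc 1 B = Ioc 0 B from rfl, show Icc 1 R = Ioc 0 R from rfl,
        Finset.sum_Ioc_consecutive _ (Nat.zero_le R) h.le]
    have h1 := abs_sum_Icc_mul_sawtooth_le_sq Y R
    have h2 : (R : ℝ) * R ≤ B * √Y := by gcongr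
    have h3 := abs_sum_Ioc_mul_sawtooth_le Y hY0 h
    have h4 : Y / (R + 1) ≤ √Y := by
      rw [div_le_iff₀ (by positivity)]
      nlinarith [Real.mul_self_sqrt hY0.le, Real.sqrt_nonneg Y]
    have h5 : 2 * B * (Y / (R + 1)) ≤ 2 * B * √Y := by gcongr
    rw [e]
    refine (abs_add_le _ _).trans ?_
    linarith

lemma sum_Icc_div_comm {M : Type*} [AddCommMonoid M] (N : ℕ) (f : ℕ → ℕ → M) :
    ∑ d ∈ Icc 1 N, ∑ m ∈ Icc 1 (N / d), f d m = ∑ m ∈ Icc 1 N, ∑ d ∈ Icc 1 (N / m), f d m := by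
  rw [← sum_Icc_sum_divisorsAntidiagonal N f,
    ← sum_Icc_sum_divisorsAntidiagonal N (fun m d => f d m)]
  refine Finset.sum_congr rfl fun q _ => ?_
  conv_lhs => rw [← Nat.map_swap_divisorsAntidiagonal, Finset.sum_map]
  rfl

lemma sum_Icc_inv_sq_le_two (N : ℕ) : ∑ m ∈ Icc 1 N, ((m : ℝ) ^ 2)⁻¹ ≤ 2 := by
  have h := sum_Ioo_inv_sq_le (α := ℝ) 0 (N + 1)
  have e : Ioo 0 (N + 1) = Icc 1 N := by
    ext m; simp only [Finset.mem_Ioo, Finset.mem_Icc]; omega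
  rw [e] at h
  simpa using h

lemma sum_Icc_inv_sqrt_le (N : ℕ) : ∑ m ∈ Icc 1 N, (√(m : ℝ))⁻¹ ≤ 2 * √(N : ℝ) := by
  induction N with
  | zero => simp
  | succ n ih =>
    rw [Finset.sum_Icc_succ_top (by omega)]
    have h0 : 0 < √((n + 1 : ℕ) : ℝ) := Real.sqrt_pos.2 (by positivity)
    have h1 : √((n + 1 : ℕ) : ℝ) * √((n + 1 : ℕ) : ℝ) = n + 1 := by
      rw [Real.mul_self_sqrt (by positivity)]; push_cast; ring
    have h2 : √(n : ℝ) * √(n : ℝ) = n := Real.mul_self_sqrt (by positivity)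
    have h3 : (√((n + 1 : ℕ) : ℝ))⁻¹ ≤ 2 * √((n + 1 : ℕ) : ℝ) - 2 * √(n : ℝ) := by
      rw [inv_le_iff_one_le_mul₀ h0]
      nlinarith [sq_nonneg (√((n + 1 : ℕ) : ℝ) - √(n : ℝ))]
    linarith

lemma sum_divisors_moebius_gcd_expansion (N c d : ℕ) (hc : 0 < c) (hcN : c ≤ N)
    (f : ℕ → ℝ) :
    ∑ g ∈ Icc 1 N, ∑ e ∈ Icc 1 (N / g), (ArithmeticFunction.moebius e : ℝ) * f g *
      (if g * e ∣ c ∧ g * e ∣ d then 1 else 0) = f (Nat.gcd c d) := by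
  set G := Nat.gcd c d
  have hG : 0 < G := Nat.gcd_pos_of_pos_left _ hc
  have hGN : G ≤ N := (Nat.le_of_dvd hc (Nat.gcd_dvd_left c d)).trans hcN
  have h : ∀ g ∈ Icc 1 N, ∑ e ∈ Icc 1 (N / g), (ArithmeticFunction.moebius e : ℝ) * f g *
      (if g * e ∣ c ∧ g * e ∣ d then 1 else 0) = if g = G then f G else 0 := by
    intro g hg
    rw [Finset.mem_Icc] at hg
    simp only [← Nat.dvd_gcd_iff]
    by_cases hgG : g ∣ G
    · obtain ⟨h, hh⟩ := hgG
      have hh0 : 0 < h := Nat.pos_of_ne_zero (by rintro rfl; simp at hh; omega)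
      have hset : (Icc 1 (N / g)).filter (fun e => g * e ∣ G) = h.divisors := by
        ext e
        rw [Finset.mem_filter, Finset.mem_Icc, Nat.mem_divisors, hh,
          Nat.mul_dvd_mul_iff_left (by omega)]
        constructor
        · exact fun H => ⟨H.2, hh0.ne'⟩
        · rintro ⟨H, -⟩
          refine ⟨⟨Nat.pos_of_dvd_of_pos H hh0, (Nat.le_of_dvd hh0 H).trans ?_⟩, H⟩
          rw [Nat.le_div_iff_mul_le (by omega), mul_comm, ← hh]
          exact hGN
      simp only [mul_ite, mul_one, mul_zero]
      rw [← Finset.sum_filter, hset, ← Finset.sum_mul]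
      have := sum_divisors_moebius_eq h
      have h2 : (∑ e ∈ h.divisors, (ArithmeticFunction.moebius e : ℝ)) =
          if h = 1 then 1 else 0 := by exact_mod_cast this
      rw [h2]
      by_cases h1 : h = 1
      · have : g = G := by rw [hh, h1, mul_one]
        simp [h1, this]
      · have : g ≠ G := by
          intro hgG
          rw [← hgG] at hh
          exact h1 (Nat.eq_of_mul_eq_mul_left (by omega : 0 < g) (by rw [← hh, mul_one]))
        simp [h1, this]
    · rw [if_neg (by rintro rfl; exact hgG dvd_rfl)]
      refine Finset.sum_eq_zero fun e _ => ?_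
      rw [if_neg (fun H => hgG ((dvd_mul_right g e).trans H)), mul_zero]
  rw [Finset.sum_congr rfl h, Finset.sum_ite_eq', if_pos (Finset.mem_Icc.2 ⟨hG, hGN⟩)]

lemma sawtoothSum_one_eq (N : ℕ) (y : ℝ) :
    sawtoothSum 1 N y = ∑ g ∈ Icc 1 N, ∑ e ∈ Icc 1 (N / g), (ArithmeticFunction.moebius e : ℝ) *
      ∑ b ∈ Icc 1 (N / (g * e)), ((g * e * b : ℕ) : ℝ) * mertensSum (N / (g * e * b)) *
      ∑ a ∈ Icc 1 (N / (g * e)), ((g * e * a : ℕ) : ℝ) * mertensSum (N / (g * e * a)) *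
        sawtooth (y / (g * e * e * b : ℕ) / a) := by
  unfold sawtoothSum
  set W : ℕ → ℝ := fun c => (c : ℝ) * mertensSum (N / c) with hW
  have h1 : ∀ c ∈ Icc 1 N, ∀ d ∈ Icc 1 N, ((c : ℝ) ^ 1 * mertensSum (N / c)) *
      ((d : ℝ) ^ 1 * mertensSum (N / d)) * sawtooth (y / ((Nat.lcm c d : ℕ) : ℝ) ^ 1) =
      ∑ g ∈ Icc 1 N, ∑ e ∈ Icc 1 (N / g), (ArithmeticFunction.moebius e : ℝ) *
        (if g * e ∣ d then W d * (if g * e ∣ c then W c *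
          sawtooth (y * g / (c * d)) else 0) else 0) := by
    intro c hc d hd
    rw [Finset.mem_Icc] at hc hd
    have hl : (Nat.gcd c d : ℝ) * (Nat.lcm c d : ℝ) = c * d := by
      exact_mod_cast Nat.gcd_mul_lcm c d
    have hl0 : (Nat.lcm c d : ℝ) ≠ 0 := by exact_mod_cast (Nat.lcm_pos hc.1 hd.1).ne'
    have hg0 : (Nat.gcd c d : ℝ) ≠ 0 := by
      exact_mod_cast (Nat.gcd_pos_of_pos_left d hc.1).ne'
    have := sum_divisors_moebius_gcd_expansion N c d hc.1 hc.2
      (fun g => W c * W d * sawtooth (y * g / (c * d)))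
    have harg : y * (Nat.gcd c d : ℝ) / (c * d) = y / (Nat.lcm c d : ℝ) ^ 1 := by
      rw [← hl]; field_simp
    rw [harg] at this
    simp only [pow_one] at this ⊢
    rw [← this]
    refine Finset.sum_congr rfl fun g _ => Finset.sum_congr rfl fun e _ => ?_
    by_cases i1 : g * e ∣ c <;> by_cases i2 : g * e ∣ d <;> simp [i1, i2]
    exact Or.inl (by ring)
  rw [Finset.sum_congr rfl fun c hc => Finset.sum_congr rfl (h1 c hc)]
  rw [Finset.sum_congr rfl fun c _ => Finset.sum_comm, Finset.sum_comm]
  refine Finset.sum_congr rfl fun g hg => ?_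
  rw [Finset.sum_congr rfl fun c _ => Finset.sum_comm, Finset.sum_comm]
  refine Finset.sum_congr rfl fun e he => ?_
  rw [Finset.mem_Icc] at hg he
  have hge : 0 < g * e := Nat.mul_pos hg.1 he.1
  have hg0 : (g : ℝ) ≠ 0 := by exact_mod_cast (by omega : g ≠ 0)
  simp only [← Finset.mul_sum]
  congr 1
  rw [Finset.sum_comm]
  have h2 : ∀ d ∈ Icc 1 N, ∑ c ∈ Icc 1 N, (if g * e ∣ d then W d * (if g * e ∣ c then W c *
      sawtooth (y * g / (c * d)) else 0) else 0) = if g * e ∣ d then W d *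
      ∑ a ∈ Icc 1 (N / (g * e)), W (g * e * a) *
        sawtooth (y * g / ((g * e * a : ℕ) * d)) else 0 := by
    intro d _
    rw [← sum_Icc_ite_dvd N (g * e) hge (fun c => W c * sawtooth (y * g / (c * d)))]
    split_ifs
    · rw [Finset.mul_sum]
    · simp
  rw [Finset.sum_congr rfl h2, sum_Icc_ite_dvd N (g * e) hge (fun d => W d *
      ∑ a ∈ Icc 1 (N / (g * e)), W (g * e * a) *
        sawtooth (y * g / ((g * e * a : ℕ) * d)))]
  refine Finset.sum_congr rfl fun b _ => ?_
  simp only [hW]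
  congr 1
  refine Finset.sum_congr rfl fun a _ => ?_
  congr 2
  rw [div_div]
  push_cast
  rw [mul_comm y, show (g : ℝ) * e * a * (g * e * b) = g * (g * e * e * b * a) by ring,
    mul_div_mul_left _ _ hg0]

lemma abs_sum_mul_mertensSum_mul_sawtooth_le (K : ℕ) (Y : ℝ) (hY : 1 ≤ Y) :
    |∑ a ∈ Icc 1 K, (a : ℝ) * mertensSum (K / a) * sawtooth (Y / a)| ≤
      3 * (2 * ((K : ℝ) ^ 3 / Y) + K * √Y * (1 + Real.log K)) := by
  have h1 : ∑ a ∈ Icc 1 K, (a : ℝ) * mertensSum (K / a) * sawtooth (Y / a) =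
      ∑ m ∈ Icc 1 K, (ArithmeticFunction.moebius m : ℝ) *
        ∑ a ∈ Icc 1 (K / m), (a : ℝ) * sawtooth (Y / a) := by
    simp only [Finset.mul_sum]
    rw [← sum_Icc_div_comm K (fun a m => (ArithmeticFunction.moebius m : ℝ) *
      ((a : ℝ) * sawtooth (Y / a)))]
    refine Finset.sum_congr rfl fun a _ => ?_
    rw [← Finset.sum_mul, mertensSum]
    ring
  have hY0 : 0 < Y := by linarith
  rw [h1]
  calc _ ≤ ∑ m ∈ Icc 1 K, 3 * ((K : ℝ) ^ 3 / Y * ((m : ℝ) ^ 2)⁻¹ + K * √Y * (m : ℝ)⁻¹) := by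
        refine (Finset.abs_sum_le_sum_abs _ _).trans (Finset.sum_le_sum fun m hm => ?_)
        rw [Finset.mem_Icc] at hm
        have hm1 : (1 : ℝ) ≤ m := by exact_mod_cast hm.1
        rw [abs_mul]
        refine (mul_le_of_le_one_left (abs_nonneg _) (abs_moebius_cast_le_one m)).trans ?_
        refine (abs_sum_Icc_mul_sawtooth_le Y hY (K / m)).trans ?_
        have hd : ((K / m : ℕ) : ℝ) ≤ K / m := Nat.cast_div_le
        calc _ ≤ 3 * (((K : ℝ) / m) ^ 3 / Y + (K : ℝ) / m * √Y) := by gcongr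
          _ = 3 * ((K : ℝ) ^ 3 / Y * ((m : ℝ) ^ 3)⁻¹ + K * √Y * (m : ℝ)⁻¹) := by
              rw [div_pow]; ring
          _ ≤ _ := by gcongr; norm_num
    _ = 3 * ((K : ℝ) ^ 3 / Y * ∑ m ∈ Icc 1 K, ((m : ℝ) ^ 2)⁻¹ +
          K * √Y * ∑ m ∈ Icc 1 K, (m : ℝ)⁻¹) := by
        rw [← Finset.mul_sum, Finset.sum_add_distrib, ← Finset.mul_sum, ← Finset.mul_sum]
    _ ≤ 3 * ((K : ℝ) ^ 3 / Y * 2 + K * √Y * (1 + Real.log K)) := by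
        gcongr
        · exact sum_Icc_inv_sq_le_two K
        · exact sum_Icc_inv_le_one_add_log K
    _ = _ := by ring

lemma abs_sum_gcd_block_le (N g e : ℕ) (hg : 0 < g) (he : 0 < e) (hgN : g * e ≤ N)
    (y : ℝ) (hy : (N : ℝ) ^ 2 ≤ y) :
    |∑ b ∈ Icc 1 (N / (g * e)), ((g * e * b : ℕ) : ℝ) * mertensSum (N / (g * e * b)) *
      ∑ a ∈ Icc 1 (N / (g * e)), ((g * e * a : ℕ) : ℝ) * mertensSum (N / (g * e * a)) *
        sawtooth (y / (g * e * e * b : ℕ) / a)| ≤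
      6 * ((N : ℝ) ^ 6 / y) * (((g : ℝ) ^ 2)⁻¹ * ((e : ℝ) ^ 2)⁻¹) +
      6 * ((N : ℝ) ^ 2 * √N * √y * (1 + Real.log N)) * ((g : ℝ)⁻¹ * (e : ℝ)⁻¹) := by
  have hg1 : (1 : ℝ) ≤ g := by exact_mod_cast hg
  have he1 : (1 : ℝ) ≤ e := by exact_mod_cast he
  have hge : 0 < g * e := Nat.mul_pos hg he
  have hge0 : (0 : ℝ) < (g : ℝ) * e := by positivity
  have hN1 : (1 : ℝ) ≤ N := by exact_mod_cast (by omega : 1 ≤ N)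
  have hy0 : 0 < y := by nlinarith
  set K := N / (g * e) with hK
  have hK1 : 1 ≤ K := Nat.div_pos hgN hge
  have hKr : (K : ℝ) ≤ N / (g * e) := by
    have : ((N / (g * e) : ℕ) : ℝ) ≤ N / ((g * e : ℕ) : ℝ) := Nat.cast_div_le
    simpa using this
  have hKN : (K : ℝ) ≤ N := by exact_mod_cast Nat.div_le_self N (g * e)
  have hgeK : (g : ℝ) * e * K ≤ N := by
    rw [le_div_iff₀ hge0] at hKr; linarith
  have hL : Real.log K ≤ Real.log N := Real.log_le_log (by exact_mod_cast hK1) hKN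
  have hL0 : 0 ≤ Real.log N := Real.log_nonneg hN1
  have hterm : ∀ b ∈ Icc 1 K, |((g * e * b : ℕ) : ℝ) * mertensSum (N / (g * e * b)) *
      ∑ a ∈ Icc 1 K, ((g * e * a : ℕ) : ℝ) * mertensSum (N / (g * e * a)) *
        sawtooth (y / (g * e * e * b : ℕ) / a)| ≤
      6 * ((N : ℝ) ^ 4 / y) * (g : ℝ)⁻¹ * K +
      3 * ((N : ℝ) ^ 2 * √y * (1 + Real.log N)) * ((√g)⁻¹ * (e : ℝ)⁻¹) * (√b)⁻¹ := by
    intro b hb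
    rw [Finset.mem_Icc] at hb
    have hb1 : (1 : ℝ) ≤ b := by exact_mod_cast hb.1
    have hbK : (b : ℝ) ≤ K := by exact_mod_cast hb.2
    have hW : |((g * e * b : ℕ) : ℝ) * mertensSum (N / (g * e * b))| ≤ N := by
      have hp : (0 : ℝ) < ((g * e * b : ℕ) : ℝ) := by
        exact_mod_cast Nat.mul_pos hge hb.1
      rw [abs_mul, Nat.abs_cast]
      calc _ ≤ ((g * e * b : ℕ) : ℝ) * ((N : ℝ) / (g * e * b : ℕ)) := by
            gcongr
            exact (abs_mertensSum_le _).trans Nat.cast_div_le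
        _ = N := by field_simp
    set Y : ℝ := y / (g * e * e * b : ℕ) with hYdef
    have hYe : Y = y / (g * e * e * b) := by rw [hYdef]; push_cast; rfl
    have hden : (g : ℝ) * e * e * b ≤ y := by
      have h1 : (e : ℝ) ≤ N := by
        exact_mod_cast (Nat.le_mul_of_pos_left e hg).trans hgN
      calc (g : ℝ) * e * e * b ≤ (g * e * K) * e := by
            rw [show (g : ℝ) * e * e * b = (g * e * b) * e by ring]; gcongr
        _ ≤ N * N := by gcongr
        _ ≤ y := by linarith [sq (N : ℝ)]
    have hY1 : 1 ≤ Y := by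
      rw [hYe, le_div_iff₀ (by positivity)]; linarith
    have hI : ∑ a ∈ Icc 1 K, ((g * e * a : ℕ) : ℝ) * mertensSum (N / (g * e * a)) *
        sawtooth (Y / a) = (g * e) * ∑ a ∈ Icc 1 K, (a : ℝ) * mertensSum (K / a) *
        sawtooth (Y / a) := by
      rw [Finset.mul_sum]
      refine Finset.sum_congr rfl fun a _ => ?_
      rw [← Nat.div_div_eq_div_mul]
      push_cast
      ring
    have hin := abs_sum_mul_mertensSum_mul_sawtooth_le K Y hY1
    rw [hI, abs_mul, abs_mul ((g : ℝ) * e), abs_of_pos hge0]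
    have hsY : √Y ≤ √y * ((√g)⁻¹ * (e : ℝ)⁻¹ * (√b)⁻¹) := by
      have : √Y = √y * ((√g)⁻¹ * (e : ℝ)⁻¹ * (√b)⁻¹) := by
        rw [hYe, Real.sqrt_div hy0.le, Real.sqrt_mul (by positivity),
          mul_assoc (g : ℝ), Real.sqrt_mul (by positivity), Real.sqrt_mul_self (by positivity)]
        field_simp
      exact this.le
    have hK3 : (g : ℝ) * e * ((K : ℝ) ^ 3 / Y) ≤ N ^ 3 / y * (g : ℝ)⁻¹ * K := by
      rw [hYe]
      have e1 : (g : ℝ) * e * ((K : ℝ) ^ 3 / (y / (g * e * e * b))) =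
          (g * e * K) ^ 3 / y * (g : ℝ)⁻¹ * b := by field_simp
      rw [e1]
      gcongr
    calc _ ≤ (N : ℝ) * (g * e * (3 * (2 * ((K : ℝ) ^ 3 / Y) + K * √Y * (1 + Real.log K)))) := by
          gcongr
      _ = 6 * N * (g * e * ((K : ℝ) ^ 3 / Y)) + 3 * N * (g * e * K) * √Y * (1 + Real.log K) := by
          ring
      _ ≤ 6 * N * (N ^ 3 / y * (g : ℝ)⁻¹ * K) +
          3 * N * N * (√y * ((√g)⁻¹ * (e : ℝ)⁻¹ * (√b)⁻¹)) * (1 + Real.log N) := by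
          have : 0 ≤ 1 + Real.log (K : ℝ) := by
            have := Real.log_nonneg (show (1 : ℝ) ≤ K by exact_mod_cast hK1)
            linarith
          gcongr
      _ = _ := by ring
  refine (Finset.abs_sum_le_sum_abs _ _).trans ((Finset.sum_le_sum hterm).trans ?_)
  simp only [Finset.sum_add_distrib, ← Finset.mul_sum, Finset.sum_const, Nat.card_Icc]
  have hs := sum_Icc_inv_sqrt_le K
  have hsK : √(K : ℝ) ≤ √N * (√g)⁻¹ := by
    have : (K : ℝ) ≤ N / g := hKr.trans (by gcongr; nlinarith)
    calc √(K : ℝ) ≤ √(N / g : ℝ) := Real.sqrt_le_sqrt this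
      _ = _ := by rw [Real.sqrt_div (by positivity)]; rfl
  have hgg : (√(g : ℝ))⁻¹ * (√(g : ℝ))⁻¹ = (g : ℝ)⁻¹ := by
    rw [← mul_inv, Real.mul_self_sqrt (by positivity)]
  refine add_le_add ?_ ?_
  · simp only [nsmul_eq_mul, Nat.add_sub_cancel]
    calc 6 * ((N : ℝ) ^ 4 / y) * (g : ℝ)⁻¹ * (K * K)
        = 6 * ((N : ℝ) ^ 4 / y) * (g : ℝ)⁻¹ * K ^ 2 := by ring
      _ ≤ 6 * ((N : ℝ) ^ 4 / y) * 1 * (N / (g * e)) ^ 2 := by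
          gcongr
          exact inv_le_one_of_one_le₀ hg1
      _ = 6 * ((N : ℝ) ^ 6 / y) * (((g : ℝ) ^ 2)⁻¹ * ((e : ℝ) ^ 2)⁻¹) := by field_simp
  · calc _ ≤ 3 * ((N : ℝ) ^ 2 * √y * (1 + Real.log N)) * ((√g)⁻¹ * (e : ℝ)⁻¹) *
          (2 * (√N * (√g)⁻¹)) := by
          gcongr
          linarith
      _ = 6 * ((N : ℝ) ^ 2 * √N * √y * (1 + Real.log N)) *
          (((√g)⁻¹ * (√g)⁻¹) * (e : ℝ)⁻¹) := by ring
      _ = _ := by rw [hgg]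

lemma abs_sawtoothSum_one_le (N : ℕ) (hN : 0 < N) (y : ℝ) (hy : (N : ℝ) ^ 2 ≤ y) :
    |sawtoothSum 1 N y| ≤ 24 * ((N : ℝ) ^ 6 / y) +
      6 * ((N : ℝ) ^ 2 * √N * √y * (1 + Real.log N) ^ 3) := by
  have hN1 : (1 : ℝ) ≤ N := by exact_mod_cast hN
  have hy0 : 0 < y := by nlinarith
  have hL0 : 0 ≤ Real.log N := Real.log_nonneg hN1
  rw [sawtoothSum_one_eq]
  set A : ℝ := 6 * ((N : ℝ) ^ 6 / y) with hA
  set B : ℝ := 6 * ((N : ℝ) ^ 2 * √N * √y * (1 + Real.log N)) with hB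
  have hA0 : 0 ≤ A := by positivity
  have hB0 : 0 ≤ B := by positivity
  calc _ ≤ ∑ g ∈ Icc 1 N, ∑ e ∈ Icc 1 N, (A * (((g : ℝ) ^ 2)⁻¹ * ((e : ℝ) ^ 2)⁻¹) +
        B * ((g : ℝ)⁻¹ * (e : ℝ)⁻¹)) := by
        refine (Finset.abs_sum_le_sum_abs _ _).trans (Finset.sum_le_sum fun g hg => ?_)
        rw [Finset.mem_Icc] at hg
        refine (Finset.abs_sum_le_sum_abs _ _).trans ?_
        refine le_trans (Finset.sum_le_sum fun e he => ?_)
          (Finset.sum_le_sum_of_subset_of_nonneg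
            (Finset.Icc_subset_Icc_right (Nat.div_le_self N g)) fun e _ _ => by positivity)
        rw [Finset.mem_Icc, Nat.le_div_iff_mul_le (by omega), mul_comm e g] at he
        rw [abs_mul]
        exact (mul_le_of_le_one_left (abs_nonneg _) (abs_moebius_cast_le_one e)).trans
          (abs_sum_gcd_block_le N g e hg.1 he.1 he.2 y hy)
    _ = A * ((∑ g ∈ Icc 1 N, ((g : ℝ) ^ 2)⁻¹) * ∑ e ∈ Icc 1 N, ((e : ℝ) ^ 2)⁻¹) +
        B * ((∑ g ∈ Icc 1 N, (g : ℝ)⁻¹) * ∑ e ∈ Icc 1 N, (e : ℝ)⁻¹) := by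
        rw [Finset.sum_mul_sum, Finset.sum_mul_sum]
        simp only [Finset.sum_add_distrib, Finset.mul_sum]
    _ ≤ A * (2 * 2) + B * ((1 + Real.log N) * (1 + Real.log N)) := by
        have h1 := sum_Icc_inv_sq_le_two N
        have h2 := sum_Icc_inv_le_one_add_log N
        gcongr
    _ = _ := by rw [hA, hB]; ring

lemma abs_second_moment_sub_le {y J P E a : ℝ} (hy : 0 ≤ y) (h : |J - P| ≤ a) :
    |y * J - J ^ 2 / 2 - E - y * P + P ^ 2 / 2| ≤ y * a + a * (2 * |J| + a) / 2 + |E| := by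
  have hP : |P| ≤ |J| + a := by
    have := abs_sub_abs_le_abs_sub P J
    rw [abs_sub_comm] at this
    linarith
  have e : y * J - J ^ 2 / 2 - E - y * P + P ^ 2 / 2 =
      y * (J - P) - (J - P) * (J + P) / 2 - E := by ring
  have h1 : |y * (J - P)| ≤ y * a := by
    rw [abs_mul, abs_of_nonneg hy]; gcongr
  have h2 : |(J - P) * (J + P) / 2| ≤ a * (2 * |J| + a) / 2 := by
    rw [abs_div, abs_mul, abs_two]
    have : |J + P| ≤ 2 * |J| + a := (abs_add_le J P).trans (by linarith)
    have ha : 0 ≤ a := (abs_nonneg _).trans h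
    gcongr
  rw [e]
  refine (abs_sub _ _).trans ?_
  have := abs_sub (y * (J - P)) ((J - P) * (J + P) / 2)
  linarith

lemma abs_sawtoothSum_floor_le (β : ℕ) (hβ : β = 1 ∨ β = 2) (x y : ℝ) (hx : 3 ≤ x)
    (hxy : x ^ (2 * β) < y) :
    |sawtoothSum β ⌊x⌋₊ y| ≤ 24 * (y⁻¹ * x ^ (2 + 4 * β)) +
      48 * (y * (√x * x ^ β) * Real.log x ^ 3) := by
  have hx0 : 0 < x := by linarith
  have hy0 : 0 < y := lt_trans (by positivity) hxy
  have hlog := one_le_log_of_three_le hx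
  have hNx : (⌊x⌋₊ : ℝ) ≤ x := Nat.floor_le hx0.le
  have hN : 0 < ⌊x⌋₊ := Nat.floor_pos.2 (by linarith)
  have hsx : 1 ≤ √x := Real.one_le_sqrt.2 (by linarith)
  rcases hβ with rfl | rfl
  · have hx2 : x ^ 2 < y := by simpa using hxy
    have hxs : x ≤ √y := Real.le_sqrt_of_sq_le hx2.le
    have hN2 : (⌊x⌋₊ : ℝ) ^ 2 ≤ y := le_trans (by gcongr) hx2.le
    have hL : 1 + Real.log ⌊x⌋₊ ≤ 2 * Real.log x := by
      have := Real.log_le_log (by exact_mod_cast hN) hNx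
      linarith
    have hL0 : 0 ≤ Real.log (⌊x⌋₊ : ℝ) := Real.log_natCast_nonneg _
    refine (abs_sawtoothSum_one_le _ hN y hN2).trans ?_
    calc _ ≤ 24 * (x ^ 6 / y) + 6 * (x ^ 2 * √x * √y * (2 * Real.log x) ^ 3) := by gcongr
      _ = 24 * (y⁻¹ * x ^ (2 + 4 * 1)) + 48 * ((x * √y) * (√x * x ^ 1) * Real.log x ^ 3) := by ring
      _ ≤ 24 * (y⁻¹ * x ^ (2 + 4 * 1)) + 48 * ((√y * √y) * (√x * x ^ 1) * Real.log x ^ 3) := by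
          gcongr
      _ = _ := by rw [Real.mul_self_sqrt hy0.le]
  · refine (abs_sawtoothSum_le 2 _ (by norm_num) y).trans ?_
    have h1 : x ^ 4 ≤ y := by simpa using hxy.le
    have hl3 : 1 ≤ Real.log x ^ 3 := one_le_pow₀ hlog
    calc ((⌊x⌋₊ : ℝ) ^ (1 + 2)) ^ 2 ≤ (x ^ (1 + 2)) ^ 2 := by gcongr
      _ = x ^ 4 * (1 * x ^ 2) * 1 := by ring
      _ ≤ y * (√x * x ^ 2) * Real.log x ^ 3 := by gcongr
      _ ≤ 0 + 48 * (y * (√x * x ^ 2) * Real.log x ^ 3) := by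
          have : 0 ≤ y * (√x * x ^ 2) * Real.log x ^ 3 := by positivity
          linarith
      _ ≤ _ := by gcongr; positivity


theorem second_moment_sharp_small_beta (β : ℕ) (hβ : β = 1 ∨ β = 2) :
    ∃ C > 0, ∀ x y : ℝ, 3 ≤ x →
      (x : ℝ) ^ (2 * β) < y →
      y < x ^ (2 * β + β ^ 2) * (Real.log x) ^ ((5 / 2 : ℝ) * ((β : ℝ) + 1)) →
      ‖momentC 2 β x y -
          ((y * x ^ (1 + β) : ℝ) : ℂ) / ((1 + (β : ℂ)) * riemannZeta (1 + (β : ℂ))) +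
          ((x ^ (2 + 2 * β) : ℝ) : ℂ) /
            (2 * (1 + (β : ℂ)) ^ 2 * (riemannZeta (1 + (β : ℂ))) ^ 2)‖ ≤
        C * (y⁻¹ * x ^ (2 + 4 * β)
          + x ^ (2 * β + 1) * (Real.log x + Real.log (Real.log x))
          + x ^ (2 * β) * y ^ ((1 : ℝ) / 3 + 1 / (6 * (β : ℝ))) * (Real.log y) ^ 5 *
              Real.log (Real.log y) * ((Real.log x) ^ 4 + (Real.log (Real.log x)) ^ 4)
          + y * x ^ ((1 : ℝ) / 2 + (β : ℝ)) *
              ((Real.log x) ^ 3 + (Real.log (Real.log x)) ^ 3)) := by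
  refine ⟨100, by norm_num, fun x y hx hxy _ => ?_⟩
  have hβ0 : 0 < β := by omega
  have hx0 : 0 < x := by linarith
  have hx1 : 1 ≤ x := by linarith
  have hxy' : x < y := lt_of_le_of_lt (le_self_pow₀ hx1 (by omega)) hxy
  have hy0 : 0 < y := by linarith
  have hlog := one_le_log_of_three_le hx
  have hlogx : Real.log x ≤ x := (Real.log_le_sub_one_of_pos hx0).trans (by linarith)
  have hlogy : 1 ≤ Real.log y := one_le_log_of_three_le (by linarith)
  have hllx : 0 ≤ Real.log (Real.log x) := Real.log_nonneg hlog
  have hlly : 0 ≤ Real.log (Real.log y) := Real.log_nonneg hlogy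
  have hrpow : x ^ ((1 : ℝ) / 2 + (β : ℝ)) = √x * x ^ β := by
    rw [Real.rpow_add hx0, Real.rpow_natCast, Real.sqrt_eq_rpow]
  have hζ := zeta_mul_moebiusSeries β hβ0
  have hζ0 : riemannZeta (1 + (β : ℂ)) ≠ 0 := left_ne_zero_of_mul_eq_one hζ
  have hS : (moebiusSeries β : ℂ) = (riemannZeta (1 + (β : ℂ)))⁻¹ :=
    (inv_eq_of_mul_eq_one_right hζ).symm
  have hβ1 : (1 + (β : ℂ)) ≠ 0 := by
    have : ((1 + β : ℕ) : ℂ) ≠ 0 := Nat.cast_ne_zero.2 (by omega)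
    simpa using this
  set J := jordanSum β ⌊x⌋₊ with hJ
  set E := sawtoothSum β ⌊x⌋₊ y with hE
  set P : ℝ := x ^ (1 + β) / (1 + β) * moebiusSeries β with hP
  have hmain : momentC 2 β x y -
      ((y * x ^ (1 + β) : ℝ) : ℂ) / ((1 + (β : ℂ)) * riemannZeta (1 + (β : ℂ))) +
      ((x ^ (2 + 2 * β) : ℝ) : ℂ) /
        (2 * (1 + (β : ℂ)) ^ 2 * (riemannZeta (1 + (β : ℂ))) ^ 2) =
      ((y * J - J ^ 2 / 2 - E - y * P + P ^ 2 / 2 : ℝ) : ℂ) := by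
    rw [momentC_two_eq β hβ0 x y hy0.le, hP]
    push_cast
    rw [hS]
    field_simp
    ring
  rw [hmain, Complex.norm_real, Real.norm_eq_abs, hrpow]
  have hJP : |J - P| ≤ 4 * x ^ β * Real.log x := abs_jordanSum_sub_le β hβ x hx
  have hJx : |J| ≤ x ^ (1 + β) := by
    refine (abs_jordanSum_le β _ hβ0).trans ?_
    gcongr
    exact Nat.floor_le hx0.le
  have hEx := abs_sawtoothSum_floor_le β hβ x y hx hxy
  have hbound := abs_second_moment_sub_le (E := E) hy0.le hJP
  have hT1 : 0 ≤ y⁻¹ * x ^ (2 + 4 * β) := by positivity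
  have hT2 : (4 * x ^ β * Real.log x) * (2 * |J| + 4 * x ^ β * Real.log x) / 2 ≤
      12 * (x ^ (2 * β + 1) * Real.log x) := by
    calc _ ≤ (4 * x ^ β * Real.log x) * (2 * x ^ (1 + β) + 4 * x ^ β * x) / 2 := by gcongr
      _ = _ := by ring
  have hT2' : 0 ≤ x ^ (2 * β + 1) * Real.log x := by positivity
  have hT2'' : 0 ≤ x ^ (2 * β + 1) * Real.log (Real.log x) := by positivity
  have hT3 : 0 ≤ x ^ (2 * β) * y ^ ((1 : ℝ) / 3 + 1 / (6 * (β : ℝ))) * (Real.log y) ^ 5 *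
      Real.log (Real.log y) * ((Real.log x) ^ 4 + (Real.log (Real.log x)) ^ 4) := by positivity
  have hT4 : y * (4 * x ^ β * Real.log x) ≤ 4 * (y * (√x * x ^ β) * Real.log x ^ 3) := by
    have hsx : 1 ≤ √x := Real.one_le_sqrt.2 hx1
    calc _ = 4 * (y * (1 * x ^ β) * Real.log x) := by ring
      _ ≤ 4 * (y * (√x * x ^ β) * Real.log x ^ 3) := by
          gcongr
          exact le_self_pow₀ hlog (by norm_num)
  have hT4' : 0 ≤ y * (√x * x ^ β) * Real.log x ^ 3 := by positivity
  have hT4'' : 0 ≤ y * (√x * x ^ β) * Real.log (Real.log x) ^ 3 := by positivity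
  rw [mul_add (x ^ (2 * β + 1)), mul_add (y * (√x * x ^ β))]
  linarith
end
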